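/- arXiv:2204.05497 — 3 statements merged into one kernel-verified Lean document; each statement's English description precedes it below -/
import Mathlib

section
/- Let p be an odd prime, G a finite p-group, and A a finite p-group acting on G. Then there exists an A-invariant subgroup K ≤ G with d(K) = d(G), such that K has nilpotency class at most 2 and [K,K] = Φ(K). -/
def AInv (A : Type*) {G : Type*} [Group A] [Group G] [MulDistribMulAction A G]
    (H : Subgroup G) : Prop :=
  ∀ (a : A) (g : G), g ∈ H → a • g ∈ H

/-- `G` is `d`-maximal for `A`-subgroups: every proper `A`-invariant subgroup
has strictly smaller minimal number of generators. -/
def DMax (A G : Type*) [Group A] [Group G] [Finite G] [MulDistribMulAction A G] : Prop :=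
  ∀ H : Subgroup G, AInv A H → H ≠ ⊤ → Group.rank H < Group.rank G

section

open Subgroup
open scoped commutatorElement

theorem Subgroup.isCoatom_of_index_prime {G : Type*} [Group G] {M : Subgroup G}
    (hM : M.index.Prime) : IsCoatom M := by
  refine ⟨fun h => hM.ne_one (by rw [h, index_top]), fun K hK => ?_⟩
  have hmul := relIndex_mul_index hK.le
  rcases (Nat.dvd_prime hM).1 (index_dvd_of_le hK.le) with h | h
  · exact index_eq_one.1 h
  · rw [h] at hmul
    have : M.relIndex K = 1 := Nat.eq_of_mul_eq_mul_right hM.pos (by rw [hmul, one_mul])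
    exact absurd (relIndex_eq_one.1 this) (not_le_of_gt hK)

theorem Group.rank_le_rank_add_one_of_index_prime {G : Type*} [Group G] [Finite G]
    {M : Subgroup G} (hM : M.index.Prime) : Group.rank G ≤ Group.rank M + 1 := by
  classical
  have hco := isCoatom_of_index_prime hM
  obtain ⟨x, -, hx⟩ := SetLike.exists_of_lt hco.lt_top
  obtain ⟨S, hS, hcl⟩ := Group.rank_spec M
  have hMle : M ≤ closure (↑(insert x (S.image (M.subtype))) : Set G) := by
    have : closure (M.subtype '' (S : Set M)) = M := by
      rw [← MonoidHom.map_closure, hcl, ← MonoidHom.range_eq_map, range_subtype]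
    refine this.symm.le.trans (closure_mono ?_)
    rw [Finset.coe_insert, Finset.coe_image]
    exact Set.subset_insert _ _
  have hxm : x ∈ closure (↑(insert x (S.image (M.subtype))) : Set G) :=
    subset_closure (by simp)
  have htop := hco.2 _ (lt_of_le_of_ne hMle fun h => hx (h ▸ hxm))
  calc Group.rank G ≤ _ := Group.rank_le htop
    _ ≤ (S.image (M.subtype)).card + 1 := Finset.card_insert_le _ _
    _ ≤ _ := by rw [← hS]; gcongr; exact Finset.card_image_le

theorem IsPGroup.pow_rank_le_card {p : ℕ} [Fact p.Prime] {G : Type*} [Group G] [Finite G]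
    (hG : IsPGroup p G) : p ^ Group.rank G ≤ Nat.card G := by
  obtain ⟨n, hn⟩ := IsPGroup.iff_card.1 hG
  rw [hn]
  refine Nat.pow_le_pow_right (Fact.out : p.Prime).pos ?_
  clear hG
  induction n generalizing G with
  | zero =>
    have : Subsingleton G := (Nat.card_eq_one_iff_unique.1 (by simpa using hn)).1
    simp [Group.rank_eq_zero]
  | succ n ih =>
    obtain ⟨M, hM⟩ := Sylow.exists_subgroup_card_pow_prime (G := G) p (n := n)
      (hn ▸ pow_dvd_pow p n.le_succ)
    have hidx : M.index = p := by
      have := M.card_mul_index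
      rw [hM, hn, pow_succ] at this
      exact Nat.eq_of_mul_eq_mul_left (pow_pos (Fact.out : p.Prime).pos n) this
    exact (Group.rank_le_rank_add_one_of_index_prime (hidx ▸ Fact.out)).trans
      (Nat.succ_le_succ (ih hM))

theorem IsPGroup.index_eq_of_isCoatom {p : ℕ} [Fact p.Prime] {G : Type*} [Group G] [Finite G]
    (hG : IsPGroup p G) {M : Subgroup G} (hM : IsCoatom M) : M.index = p := by
  obtain ⟨m, hm⟩ := IsPGroup.iff_card.1 hG
  obtain ⟨n, hn⟩ := IsPGroup.iff_card.1 (hG.to_subgroup M)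
  have hp : p.Prime := Fact.out
  have hlt : n < m := by
    have hle : Nat.card M ≤ Nat.card G := Subgroup.card_le_card_group M
    have hne : Nat.card M ≠ Nat.card G := fun h => hM.1 (eq_top_of_card_eq M h)
    rw [hm, hn] at hle hne
    exact (Nat.pow_lt_pow_iff_right hp.one_lt).1 (lt_of_le_of_ne hle hne)
  obtain ⟨K, hK, hMK⟩ := Sylow.exists_subgroup_card_pow_succ
    (hm ▸ pow_dvd_pow p (Nat.succ_le_of_lt hlt)) hn
  have hne : M ≠ K := by
    rintro rfl
    exact absurd (Nat.pow_right_injective hp.two_le (hn.symm.trans hK)) (by simp)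
  have hKtop := hM.2 K (lt_of_le_of_ne hMK hne)
  have hmul := M.card_mul_index
  rw [← card_top (G := G), ← hKtop, hK, hn, pow_succ] at hmul
  exact Nat.eq_of_mul_eq_mul_left (pow_pos hp.pos n) hmul

theorem IsPGroup.normal_of_isCoatom {p : ℕ} [Fact p.Prime] {G : Type*} [Group G] [Finite G]
    (hG : IsPGroup p G) {M : Subgroup G} (hM : IsCoatom M) : M.Normal := by
  have := hG.isNilpotent
  exact Group.normalizerCondition_of_isNilpotent.normal_of_coatom M hM

theorem IsPGroup.commutator_le_frattini {p : ℕ} [Fact p.Prime] {G : Type*} [Group G] [Finite G]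
    (hG : IsPGroup p G) : _root_.commutator G ≤ frattini G := by
  refine le_iInf₂ fun M hM => ?_
  have := hG.normal_of_isCoatom hM
  have hcard : Nat.card (G ⧸ M) = p := hG.index_eq_of_isCoatom hM
  have := isCyclic_of_prime_card hcard
  exact Normal.quotient_commutative_iff_commutator_le.1 IsCyclic.isMulCommutative

theorem IsPGroup.pow_mem_frattini {p : ℕ} [Fact p.Prime] {G : Type*} [Group G] [Finite G]
    (hG : IsPGroup p G) (x : G) : x ^ p ∈ frattini G := by
  simp only [frattini, Order.radical, mem_iInf]
  intro M hM
  have := hG.normal_of_isCoatom hM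
  have hcard : Nat.card (G ⧸ M) = p := hG.index_eq_of_isCoatom hM
  rw [← QuotientGroup.eq_one_iff, QuotientGroup.mk_pow, ← hcard, pow_card_eq_one']

theorem Group.rank_le_rank_quotient {G : Type*} [Group G] [Finite G] {N : Subgroup G} [N.Normal]
    (hN : N ≤ frattini G) : Group.rank G ≤ Group.rank (G ⧸ N) := by
  classical
  obtain ⟨S, hS, hcl⟩ := Group.rank_spec (G ⧸ N)
  have himg : QuotientGroup.mk' N '' (S.image Quotient.out : Finset G) = S := by
    ext x
    simp [Set.mem_image]
  have htop : closure ((S.image Quotient.out : Finset G) : Set G) = ⊤ := by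
    refine frattini_nongenerating (top_le_iff.1 (le_trans ?_ (sup_le_sup_left hN _)))
    have h := comap_map_eq (QuotientGroup.mk' N)
      (closure ((S.image Quotient.out : Finset G) : Set G))
    rw [MonoidHom.map_closure, himg, hcl, comap_top, QuotientGroup.ker_mk'] at h
    exact h.le
  exact (Group.rank_le htop).trans (Finset.card_image_le.trans hS.le)

theorem IsPGroup.pow_rank_le_index {p : ℕ} [Fact p.Prime] {G : Type*} [Group G] [Finite G]
    (hG : IsPGroup p G) {N : Subgroup G} [N.Normal] (hN : N ≤ frattini G) :
    p ^ Group.rank G ≤ N.index :=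
  (Nat.pow_le_pow_right (Fact.out : p.Prime).pos (Group.rank_le_rank_quotient hN)).trans
    (hG.to_quotient N).pow_rank_le_card

theorem Subgroup.index_le_pow_rank {p : ℕ} (hp : p.Prime) {G : Type*} [Group G] [Finite G]
    {N : Subgroup G} (hcomm : _root_.commutator G ≤ N) (hpow : ∀ x : G, x ^ p ∈ N) :
    N.index ≤ p ^ Group.rank G := by
  have : N.Normal := .of_commutator_le G hcomm
  have := Normal.quotient_commutative_iff_commutator_le.2 hcomm
  let : CommGroup (G ⧸ N) := { (inferInstance : Group (G ⧸ N)) with mul_comm := mul_comm' }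
  have h := card_dvd_exponent_pow_rank' (G ⧸ N) (n := p) (by
    rintro ⟨x⟩
    exact (QuotientGroup.eq_one_iff _).2 (hpow x))
  refine (Nat.le_of_dvd (pow_pos hp.pos _) h).trans (Nat.pow_le_pow_right hp.pos ?_)
  exact Group.rank_le_of_surjective (QuotientGroup.mk' N) (QuotientGroup.mk'_surjective N)

theorem mul_pow_of_mul_eq_mul_mul {G : Type*} [Group G] {t x y : G} (ht : t ∈ center G)
    (h : y * x = t * (x * y)) (n : ℕ) : (x * y) ^ n = t ^ n.choose 2 * (x ^ n * y ^ n) := by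
  have hc : ∀ k : ℕ, ∀ g : G, g * t ^ k = t ^ k * g := fun k => mem_center_iff.1 (pow_mem ht k)
  have hswap : ∀ k : ℕ, y ^ k * x = t ^ k * (x * y ^ k) := by
    intro k
    induction k with
    | zero => simp
    | succ k ih =>
      calc y ^ (k + 1) * x = y ^ k * (y * x) := by rw [pow_succ, mul_assoc]
        _ = y ^ k * t ^ 1 * (x * y) := by rw [h, pow_one, mul_assoc]
        _ = t ^ 1 * (y ^ k * x) * y := by rw [hc]; simp only [mul_assoc]
        _ = t ^ (k + 1) * (x * y ^ (k + 1)) := by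
          rw [ih, pow_succ y, add_comm k 1, pow_add]; simp only [mul_assoc]
  induction n with
  | zero => simp
  | succ n ih =>
    calc (x * y) ^ (n + 1) = t ^ n.choose 2 * (x ^ n * (y ^ n * x) * y) := by
          rw [pow_succ, ih]; simp only [mul_assoc]
      _ = t ^ n.choose 2 * ((x ^ n * t ^ n) * (x * y ^ n * y)) := by
          rw [hswap]; simp only [mul_assoc]
      _ = t ^ (n + 1).choose 2 * (x ^ (n + 1) * y ^ (n + 1)) := by
          rw [hc, Nat.choose_succ_succ' n 1, Nat.choose_one_right, add_comm n, pow_add,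
            pow_succ x, pow_succ y]
          simp only [mul_assoc]

/-- If all commutators `⁅u, x⁆` with `u` fixed lie in a central subgroup `T`, then
`x ↦ ⁅u, x⁆` is a homomorphism. -/
def commutatorRightHom {G : Type*} [Group G] {T : Subgroup G} (hT : T ≤ center G) (u : G)
    (hu : ∀ x, ⁅u, x⁆ ∈ T) : G →* T :=
  MonoidHom.mk' (fun x => ⟨⁅u, x⁆, hu x⟩) fun x y => Subtype.ext <| by
    have h := mem_center_iff.1 (hT (hu y)) x
    simp only [coe_mul]
    rw [commutatorElement_mul_right_eq_mul_conj, mul_assoc _ x, h, mul_assoc, mul_assoc,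
      mul_inv_cancel, mul_one]

section ClassThree

variable {p : ℕ} [Fact p.Prime] {G : Type*} [Group G] {T : Subgroup G}

theorem commutator_le_centralizer_commutator (hT : T ≤ center G)
    (hcomm : ⁅_root_.commutator G, (⊤ : Subgroup G)⁆ ≤ T) :
    _root_.commutator G ≤ centralizer (_root_.commutator G) := by
  rw [← commutator_eq_bot_iff_le_centralizer]
  have h : ⁅⁅_root_.commutator G, (⊤ : Subgroup G)⁆, (⊤ : Subgroup G)⁆ = ⊥ := by
    rw [commutator_eq_bot_iff_le_centralizer, coe_top, centralizer_univ]
    exact hcomm.trans hT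
  refine commutator_commutator_eq_bot_of_rotate (H₁ := (⊤ : Subgroup G))
    (H₂ := (⊤ : Subgroup G)) ?_ h
  rwa [commutator_comm (⊤ : Subgroup G) (_root_.commutator G)]

theorem pow_mem_center_of_mem_centralizer_commutator (hodd : p ≠ 2) (hT : T ≤ center G)
    (hcard : Nat.card T = p) (hcomm : ⁅_root_.commutator G, (⊤ : Subgroup G)⁆ ≤ T)
    (hpow : ∀ x : G, x ^ p ∈ _root_.commutator G) {c : G}
    (hc : c ∈ centralizer (_root_.commutator G : Set G)) : c ^ p ∈ center G := by
  refine mem_center_iff.2 fun g => ?_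
  have hcw : ∀ w ∈ _root_.commutator G, Commute w c := mem_centralizer_iff.1 hc
  have hw : ⁅c, g⁆ ∈ _root_.commutator G := commutator_mem_commutator (mem_top c) (mem_top g)
  have htT : ⁅g, ⁅c, g⁆⁆ ∈ T := hcomm (by
    rw [commutator_comm]; exact commutator_mem_commutator (mem_top g) hw)
  have htp : ⁅g, ⁅c, g⁆⁆ ^ p = 1 := by
    rw [← hcard]; exact congrArg Subtype.val (pow_card_eq_one' (x := (⟨_, htT⟩ : T)))
  have hchoose : ⁅g, ⁅c, g⁆⁆ ^ p.choose 2 = 1 := by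
    have hp : p.Prime := Fact.out
    obtain ⟨k, hk⟩ := hp.dvd_choose_self two_ne_zero (lt_of_le_of_ne hp.two_le hodd.symm)
    rw [hk, pow_mul, htp, one_pow]
  have hwg : ⁅c, g⁆ * g = c * g * c⁻¹ := by rw [commutatorElement_def]; group
  have hwp : ⁅c, g⁆ ^ p = 1 := by
    have h1 := mul_pow_of_mul_eq_mul_mul (x := ⁅c, g⁆) (y := g) (hT htT)
      (by rw [commutatorElement_def g]; group) p
    have h2 : (c * g * c⁻¹) ^ p = g ^ p := by
      rw [conj_pow, ← (hcw _ (hpow g)).eq, mul_inv_cancel_right]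
    rw [hwg, h2, hchoose, one_mul] at h1
    exact right_eq_mul.1 h1
  have hgc : g * c * g⁻¹ = ⁅c, g⁆⁻¹ * c := by rw [commutatorElement_def]; group
  have : g * c ^ p * g⁻¹ = c ^ p := by
    rw [← conj_pow, hgc, ((hcw _ hw).inv_left).mul_pow, inv_pow, hwp, inv_one, one_mul]
  rwa [mul_inv_eq_iff_eq_mul] at this

theorem index_centralizer_commutator_le [Finite G] (hG : IsPGroup p G) (hT : T ≤ center G)
    (hcard : Nat.card T = p) (hcomm : ⁅_root_.commutator G, (⊤ : Subgroup G)⁆ ≤ T) :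
    (centralizer (_root_.commutator G : Set G)).index ≤
      (center G).relIndex (_root_.commutator G) := by
  set D := (center G).subgroupOf (_root_.commutator G) with hD
  obtain ⟨S, hS, hcl⟩ := Group.rank_spec (_ ⧸ D)
  have hmem : ∀ (u : _root_.commutator G) (x : G), ⁅(u : G), x⁆ ∈ T := fun u x =>
    hcomm (commutator_mem_commutator u.2 (mem_top x))
  let f : G →* (S → T) := MonoidHom.pi fun s => commutatorRightHom hT _ (hmem s.1.out)
  have hker : f.ker ≤ centralizer (_root_.commutator G : Set G) := by
    intro x hx
    set W := (centralizer {x}).subgroupOf (_root_.commutator G) with hW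
    have hDW : D ≤ W := fun u hu => by
      rw [hW, mem_subgroupOf, mem_centralizer_singleton_iff]
      exact (mem_center_iff.1 (mem_subgroupOf.1 hu) x).symm
    have hSW : ∀ s ∈ S, s ∈ W.map (QuotientGroup.mk' D) := fun s hs => by
      refine mem_map.2 ⟨s.out, ?_, by simp⟩
      have hs1 : ⁅(s.out : G), x⁆ = 1 := congrArg Subtype.val (congrFun hx ⟨s, hs⟩)
      rw [hW, mem_subgroupOf, mem_centralizer_singleton_iff]
      exact commutatorElement_eq_one_iff_mul_comm.1 hs1
    have htop : W = ⊤ := by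
      have h := comap_map_eq (QuotientGroup.mk' D) W
      rw [top_le_iff.1 (hcl.ge.trans ((closure_le _).2 hSW)), comap_top, QuotientGroup.ker_mk',
        sup_eq_left.2 hDW] at h
      exact h.symm
    refine mem_centralizer_iff.2 fun u hu => ?_
    exact mem_centralizer_singleton_iff.1 (subgroupOf_eq_top.1 htop hu)
  calc (centralizer (_root_.commutator G : Set G)).index ≤ f.ker.index :=
        Nat.le_of_dvd (Nat.pos_of_ne_zero FiniteIndex.index_ne_zero) (index_dvd_of_le hker)
    _ = Nat.card f.range := index_ker f
    _ ≤ Nat.card (S → T) := card_le_card_group _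
    _ = p ^ Group.rank (_ ⧸ D) := by rw [Nat.card_fun, hcard, Nat.card_eq_fintype_card,
        Fintype.card_coe, hS]
    _ ≤ Nat.card (_ ⧸ D) := ((hG.to_subgroup _).to_quotient D).pow_rank_le_card

theorem rank_le_rank_centralizer_commutator [Finite G] (hG : IsPGroup p G) (hodd : p ≠ 2)
    (hT : T ≤ center G) (hcard : Nat.card T = p)
    (hcomm : ⁅_root_.commutator G, (⊤ : Subgroup G)⁆ ≤ T)
    (hpow : ∀ x : G, x ^ p ∈ _root_.commutator G) :
    Group.rank G ≤ Group.rank (centralizer (_root_.commutator G : Set G)) := by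
  have hp : p.Prime := Fact.out
  set C := centralizer (_root_.commutator G : Set G) with hC
  set D := center G ⊓ _root_.commutator G with hD
  have hle : _root_.commutator G ≤ C := commutator_le_centralizer_commutator hT hcomm
  have h1 : D.relIndex C ≤ p ^ Group.rank C := by
    refine index_le_pow_rank (N := D.subgroupOf C) hp ?_ fun x => ?_
    · rw [_root_.commutator_def, commutator_le]
      intro a _ b _
      exact mem_subgroupOf.2 (mem_inf.2 ⟨commutator_centralizer_commutator_le_center G
        (commutator_mem_commutator a.2 b.2), commutator_mem_commutator (mem_top _) (mem_top _)⟩)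
    · exact mem_subgroupOf.2 (mem_inf.2 ⟨pow_mem_center_of_mem_centralizer_commutator hodd hT hcard
        hcomm hpow x.2, hpow _⟩)
  have h2 := relIndex_mul_relIndex D (_root_.commutator G) C inf_le_right hle
  have h3 := relIndex_mul_index hle
  have h4 := index_centralizer_commutator_le hG hT hcard hcomm
  rw [← inf_relIndex_right] at h4
  have h5 := hG.pow_rank_le_index hG.commutator_le_frattini
  refine (Nat.pow_le_pow_iff_right hp.one_lt).1 (h5.trans (le_trans ?_ h1))
  rw [← h3, ← h2, mul_comm]
  exact Nat.mul_le_mul_right _ h4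

end ClassThree

section Action

variable {A G : Type*} [Group A] [Group G] [MulDistribMulAction A G]

theorem AInv.of_characteristic (A : Type*) [Group A] [MulDistribMulAction A G] (H : Subgroup G)
    [hH : H.Characteristic] : AInv A H := fun a _ hg =>
  (characteristic_iff_le_comap.1 hH (MulDistribMulAction.toMulEquiv G a)) hg

/-- The action of `A` restricted to an `A`-invariant subgroup. -/
abbrev AInv.mulDistribMulAction {H : Subgroup G} (hH : AInv A H) : MulDistribMulAction A H where
  smul a h := ⟨a • (h : G), hH a h h.2⟩
  one_smul h := Subtype.ext (one_smul A (h : G))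
  mul_smul a b h := Subtype.ext (mul_smul a b (h : G))
  smul_mul a h k := Subtype.ext (smul_mul' a (h : G) k)
  smul_one a := Subtype.ext (smul_one a)

theorem IsPGroup.exists_monoidHom_ne_one {p : ℕ} [Fact p.Prime] [Finite G] [Nontrivial G]
    (hG : IsPGroup p G) : ∃ f : G →* Multiplicative (ZMod p), f ≠ 1 := by
  obtain ⟨M, hM, -⟩ := (eq_top_or_exists_le_coatom (⊥ : Subgroup G)).resolve_left bot_ne_top
  have := hG.normal_of_isCoatom hM
  have hcard : Nat.card (G ⧸ M) = p := hG.index_eq_of_isCoatom hM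
  let e : G ⧸ M ≃* Multiplicative (ZMod p) := mulEquivOfPrimeCardEq (p := p) hcard (by simp)
  refine ⟨e.toMonoidHom.comp (QuotientGroup.mk' M), fun h => hM.1 ?_⟩
  refine eq_top_iff.2 fun x _ => ?_
  have hx : e (x : G ⧸ M) = 1 := DFunLike.congr_fun h x
  exact (QuotientGroup.eq_one_iff x).1 ((map_eq_one_iff e e.injective).1 hx)

theorem IsPGroup.exists_fixed_monoidHom_ne_one {p : ℕ} [Fact p.Prime] [Finite G]
    [Nontrivial G] (hG : IsPGroup p G) (hA : IsPGroup p A) :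
    ∃ f : G →* Multiplicative (ZMod p), f ≠ 1 ∧ ∀ (a : A) (g : G), f (a • g) = f g := by
  have hA' : IsPGroup p Aᵈᵐᵃ := fun c => by
    obtain ⟨k, hk⟩ := hA (DomMulAct.mk.symm c)
    exact ⟨k, DomMulAct.mk.symm.injective (by simpa using hk)⟩
  have : Finite (G →* Multiplicative (ZMod p)) := Finite.of_injective _ DFunLike.coe_injective
  have hV : IsPGroup p (G →* Multiplicative (ZMod p)) := fun f => ⟨1, by
    ext g
    have h := pow_card_eq_one' (x := f g)
    simp only [Nat.card_eq_fintype_card, Fintype.card_multiplicative, ZMod.card] at h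
    simp [h]⟩
  obtain ⟨f₀, hf₀⟩ := hG.exists_monoidHom_ne_one
  have hdvd : p ∣ Nat.card (G →* Multiplicative (ZMod p)) := by
    refine hV.card_eq_or_dvd.resolve_left fun h => hf₀ ?_
    have := (Nat.card_eq_one_iff_unique.1 h).1
    exact Subsingleton.elim _ _
  obtain ⟨f, hf, hne⟩ := hA'.exists_fixed_point_of_prime_dvd_card_of_fixed_point _ hdvd
    (a := 1) (fun c => by ext; simp)
  exact ⟨f, hne.symm, fun a g => DFunLike.congr_fun (hf (DomMulAct.mk a)) g⟩

theorem AInv.exists_relIndex_eq {p : ℕ} [Fact p.Prime] [Finite G] (hG : IsPGroup p G)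
    (hA : IsPGroup p A) {H : Subgroup G} (hH : AInv A H) (hne : H ≠ ⊥) :
    ∃ M ≤ H, AInv A M ∧ M.relIndex H = p := by
  let := hH.mulDistribMulAction
  have := (nontrivial_iff_ne_bot H).2 hne
  obtain ⟨f, hf, hinv⟩ := (hG.to_subgroup H).exists_fixed_monoidHom_ne_one hA
  have hp : p.Prime := Fact.out
  refine ⟨f.ker.map H.subtype, map_subtype_le _, ?_, ?_⟩
  · rintro a _ ⟨h, hh, rfl⟩
    exact ⟨a • h, (hinv a h).trans hh, rfl⟩
  · have hcard : Nat.card (Multiplicative (ZMod p)) = p := by simp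
    rw [relIndex, subgroupOf, comap_map_eq_self_of_injective H.subtype_injective, index_ker]
    refine ((Nat.dvd_prime hp).1 ((card_subgroup_dvd_card f.range).trans hcard.dvd)).resolve_left
      fun h => ?_
    exact hf (MonoidHom.range_eq_bot_iff.1 (card_eq_one.1 h))

/-- The semidirect product `G ⋊ A` acts on `G`, with `G` acting by conjugation. -/
abbrev semidirectAction (A G : Type*) [Group A] [Group G] [MulDistribMulAction A G] :
    MulDistribMulAction (G ⋊[MulDistribMulAction.toMulAut A G] A) G :=
  MulDistribMulAction.compHom G (SemidirectProduct.lift MulAut.conj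
    (MulDistribMulAction.toMulAut A G) fun a => by ext; simp)

theorem AInv.exists_normal_relIndex_eq {p : ℕ} [Fact p.Prime] [Finite A] [Finite G]
    (hG : IsPGroup p G) (hA : IsPGroup p A) {H : Subgroup G} [H.Normal] (hH : AInv A H)
    (hne : H ≠ ⊥) : ∃ N ≤ H, N.Normal ∧ AInv A N ∧ N.relIndex H = p := by
  let := semidirectAction A G
  have hΓ : IsPGroup p (G ⋊[MulDistribMulAction.toMulAut A G] A) := by
    obtain ⟨m, hm⟩ := IsPGroup.iff_card.1 hG
    obtain ⟨n, hn⟩ := IsPGroup.iff_card.1 hA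
    refine IsPGroup.of_card (n := m + n) ?_
    rw [SemidirectProduct.card, hm, hn, pow_add]
  have hsmul : ∀ (c : G ⋊[MulDistribMulAction.toMulAut A G] A) (g : G),
      c • g = c.left * (c.right • g) * c.left⁻¹ := fun _ _ => rfl
  have hinv : AInv (G ⋊[MulDistribMulAction.toMulAut A G] A) H := fun c g hg => by
    rw [hsmul]
    exact Normal.conj_mem inferInstance _ (hH _ _ hg) _
  obtain ⟨N, hNH, hN, hidx⟩ := hinv.exists_relIndex_eq hG hΓ hne
  refine ⟨N, hNH, ⟨fun n hn g => ?_⟩, fun a g hg => ?_, hidx⟩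
  · have h := hN (SemidirectProduct.inl g) n hn
    rw [hsmul] at h
    simpa using h
  · have h := hN (SemidirectProduct.inr a) g hg
    rw [hsmul] at h
    simpa using h

end Action

theorem IsPGroup.le_center_of_card_eq {p : ℕ} [Fact p.Prime] {G : Type*} [Group G] [Finite G]
    (hG : IsPGroup p G) {T : Subgroup G} [T.Normal] (hT : Nat.card T = p) : T ≤ center G := by
  have hp : p.Prime := Fact.out
  have hle : ⁅T, (⊤ : Subgroup G)⁆ ≤ T := commutator_le_left T ⊤
  rw [← centralizer_univ, ← coe_top, ← commutator_eq_bot_iff_le_centralizer]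
  rcases (Nat.dvd_prime hp).1 (hT ▸ card_dvd_of_le hle) with h | h
  · exact card_eq_one.1 h
  have heq : ⁅T, (⊤ : Subgroup G)⁆ = T := eq_of_le_of_card_ge hle (hT.trans h.symm).le
  obtain ⟨n, hn⟩ := Subgroup.nilpotent_iff_lowerCentralSeries.1 hG.isNilpotent
  have hmono : ∀ n, T ≤ (⊤ : Subgroup G).lowerCentralSeries n := by
    intro n
    induction n with
    | zero => exact le_top
    | succ n ih =>
      rw [Subgroup.lowerCentralSeries_succ, ← heq]
      exact commutator_mono ih le_rfl
  have hbot : T = ⊥ := le_bot_iff.1 (hn ▸ hmono n)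
  rw [heq, hbot]

/-- In a finite `p`-group `G`, the subgroup of those `x` with `x ^ p ∈ ⁅G, G⁆` needs at least as
many generators as `G`. -/
theorem IsPGroup.rank_le_rank_comap_ker_pow {p : ℕ} [Fact p.Prime] {G : Type*} [Group G]
    [Finite G] (hG : IsPGroup p G) :
    Group.rank G ≤ Group.rank
      ((powMonoidHom p : Abelianization G →* Abelianization G).ker.comap Abelianization.of) := by
  have hp : p.Prime := Fact.out
  set P := (powMonoidHom p : Abelianization G →* Abelianization G) with hP
  have hof : Function.Surjective (Abelianization.of : G →* Abelianization G) :=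
    QuotientGroup.mk_surjective
  have hN : P.range.comap Abelianization.of ≤ frattini G := by
    rintro x ⟨y, hy⟩
    obtain ⟨y, rfl⟩ := hof y
    have h : x * (y ^ p)⁻¹ ∈ _root_.commutator G := by
      rw [← Abelianization.ker_of, MonoidHom.mem_ker, map_mul, ← hy, map_inv, map_pow]
      simp [hP]
    have := mul_mem (hG.commutator_le_frattini h) (hG.pow_mem_frattini y)
    rwa [inv_mul_cancel_right] at this
  have h1 := hG.pow_rank_le_index hN
  rw [index_comap_of_surjective _ hof] at h1
  have h2 : P.range.index = Nat.card P.ker := by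
    have hk := P.ker.card_mul_index
    rw [index_ker, ← P.range.card_mul_index, mul_comm] at hk
    exact (Nat.eq_of_mul_eq_mul_left Nat.card_pos hk).symm
  have h3 : (_root_.commutator G).relIndex (P.ker.comap Abelianization.of) = Nat.card P.ker := by
    rw [← Abelianization.ker_of, ← MonoidHom.comap_bot Abelianization.of, relIndex_comap,
      map_comap_eq_self_of_surjective hof, relIndex_bot_left]
  have h4 : (_root_.commutator G).relIndex (P.ker.comap Abelianization.of) ≤
      p ^ Group.rank (P.ker.comap Abelianization.of) := by
    refine index_le_pow_rank (N := (_root_.commutator G).subgroupOf _) hp ?_ fun x => ?_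
    · rw [_root_.commutator_def, commutator_le]
      exact fun a _ b _ => mem_subgroupOf.2 (commutator_mem_commutator (mem_top _) (mem_top _))
    · have hx : Abelianization.of (x : G) ^ p = 1 := x.2
      rwa [← map_pow, ← MonoidHom.mem_ker, Abelianization.ker_of] at hx
  refine (Nat.pow_le_pow_iff_right hp.one_lt).1 (h1.trans ?_)
  rwa [h2, ← h3]

theorem AInv.comap_centralizer_commutator {A G : Type*} [Group A] [Group G]
    [MulDistribMulAction A G] {N : Subgroup G} [N.Normal] (hN : AInv A N) :
    AInv A ((centralizer (_root_.commutator (G ⧸ N) : Set (G ⧸ N))).comap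
      (QuotientGroup.mk' N)) := by
  have hsurj := QuotientGroup.mk'_surjective N
  have hmap : _root_.commutator (G ⧸ N) = (_root_.commutator G).map (QuotientGroup.mk' N) := by
    rw [_root_.commutator_def, _root_.commutator_def, map_commutator, map_top_of_surjective _ hsurj]
  intro a x hx
  rw [mem_comap, mem_centralizer_iff, hmap] at hx ⊢
  rintro _ ⟨u, hu, rfl⟩
  have hu' := AInv.of_characteristic A (_root_.commutator G) a⁻¹ u hu
  have h := hx _ (mem_map_of_mem _ hu')
  rw [← map_mul, ← map_mul] at h ⊢
  have h' := hN a _ (QuotientGroup.eq.1 h)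
  rw [smul_mul', smul_inv', smul_mul', smul_mul', smul_inv_smul] at h'
  exact QuotientGroup.eq.2 h'

section DMax

variable {p : ℕ} [Fact p.Prime] {A G : Type*} [Group A] [Group G] [Finite G]
  [MulDistribMulAction A G]

theorem DMax.eq_top (hD : DMax A G) {H : Subgroup G} (hH : AInv A H)
    (hrank : Group.rank G ≤ Group.rank H) : H = ⊤ := by
  by_contra h
  exact absurd (hD H hH h) (not_lt.2 hrank)

theorem DMax.pow_mem_commutator (hD : DMax A G) (hG : IsPGroup p G) (x : G) :
    x ^ p ∈ _root_.commutator G := by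
  have hmem : ∀ y : G,
      y ∈ (powMonoidHom p : Abelianization G →* Abelianization G).ker.comap Abelianization.of ↔
        y ^ p ∈ _root_.commutator G := fun y => by
    rw [← Abelianization.ker_of, mem_comap, MonoidHom.mem_ker, MonoidHom.mem_ker, map_pow]
    rfl
  have htop := hD.eq_top (fun a y hy => ?_) hG.rank_le_rank_comap_ker_pow
  · rw [← hmem, htop]
    exact mem_top x
  · rw [hmem] at hy ⊢
    rw [← smul_pow']
    exact AInv.of_characteristic A (_root_.commutator G) a _ hy

theorem DMax.commutator_eq_frattini (hD : DMax A G) (hG : IsPGroup p G) :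
    _root_.commutator G = frattini G := by
  refine le_antisymm hG.commutator_le_frattini (relIndex_eq_one.1 ?_)
  have h1 := index_le_pow_rank (p := p) Fact.out le_rfl (hD.pow_mem_commutator hG)
  have h2 := h1.trans (hG.pow_rank_le_index le_rfl)
  rw [← relIndex_mul_index hG.commutator_le_frattini] at h2
  have hpos : 0 < (frattini G).index := Nat.pos_of_ne_zero FiniteIndex.index_ne_zero
  have hpos' : (_root_.commutator G).relIndex (frattini G) ≠ 0 :=
    FiniteIndex.index_ne_zero (H := (_root_.commutator G).subgroupOf (frattini G))
  have := Nat.le_of_mul_le_mul_right (h2.trans (one_mul _).ge) hpos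
  lia

theorem DMax.commutator_commutator_eq_bot [Finite A] (hD : DMax A G) (hG : IsPGroup p G)
    (hA : IsPGroup p A) (hodd : p ≠ 2) : ⁅_root_.commutator G, (⊤ : Subgroup G)⁆ = ⊥ := by
  have hp : p.Prime := Fact.out
  by_contra hne
  obtain ⟨N, hNle, hNnormal, hN, hidx⟩ :=
    (AInv.of_characteristic A ⁅_root_.commutator G, (⊤ : Subgroup G)⁆).exists_normal_relIndex_eq
      hG hA hne
  have hsurj := QuotientGroup.mk'_surjective N
  have hmap : ⁅_root_.commutator G, (⊤ : Subgroup G)⁆.map (QuotientGroup.mk' N) =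
      ⁅_root_.commutator (G ⧸ N), (⊤ : Subgroup (G ⧸ N))⁆ := by
    rw [_root_.commutator_def, _root_.commutator_def, map_commutator, map_commutator,
      map_top_of_surjective _ hsurj]
  have hQ := hG.to_quotient N
  have hcard : Nat.card
      (⁅_root_.commutator (G ⧸ N), (⊤ : Subgroup (G ⧸ N))⁆ : Subgroup (G ⧸ N)) = p := by
    rw [← hmap, ← relIndex_bot_left, ← relIndex_comap, MonoidHom.comap_bot,
      QuotientGroup.ker_mk', hidx]
  have hcenter := hQ.le_center_of_card_eq hcard
  have hpow : ∀ x : G ⧸ N, x ^ p ∈ _root_.commutator (G ⧸ N) := by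
    intro x
    obtain ⟨x, rfl⟩ := hsurj x
    have h := mem_map_of_mem (QuotientGroup.mk' N) (hD.pow_mem_commutator hG x)
    rwa [map_pow, _root_.commutator_def, map_commutator, map_top_of_surjective _ hsurj] at h
  have hNfrat : N ≤ frattini G :=
    (hNle.trans (commutator_le_left _ _)).trans hG.commutator_le_frattini
  have htop := hD.eq_top hN.comap_centralizer_commutator <|
    (Group.rank_le_rank_quotient hNfrat).trans <|
    (rank_le_rank_centralizer_commutator hQ hodd hcenter hcard le_rfl hpow).trans <|
    Group.rank_le_of_surjective _
      (MonoidHom.subgroupComap_surjective_of_surjective (QuotientGroup.mk' N) _ hsurj)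
  have hC : centralizer (_root_.commutator (G ⧸ N) : Set (G ⧸ N)) = ⊤ := by
    rw [← comap_top (QuotientGroup.mk' N)] at htop
    exact comap_injective hsurj htop
  have hbot : ⁅_root_.commutator (G ⧸ N), (⊤ : Subgroup (G ⧸ N))⁆ = ⊥ := by
    rw [commutator_comm, commutator_eq_bot_iff_le_centralizer, hC]
  rw [hbot, card_bot] at hcard
  exact hp.ne_one hcard.symm

/-- Among the `A`-invariant subgroups needing at least as many generators as `G`, a minimal one
is `d`-maximal and needs exactly as many generators as `G`. -/
theorem exists_dMax_subgroup_rank_eq (hG : IsPGroup p G) (hA : IsPGroup p A) :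
    ∃ (K : Subgroup G) (hK : AInv A K), Group.rank K = Group.rank G ∧
      @DMax A K _ _ _ hK.mulDistribMulAction := by
  have hp : p.Prime := Fact.out
  obtain ⟨K, ⟨hK, hrank⟩, hmin⟩ := exists_minimal_of_wellFoundedLT
    (fun H : Subgroup G => AInv A H ∧ Group.rank G ≤ Group.rank H)
    ⟨⊤, fun _ _ _ => mem_top _, (Group.rank_congr topEquiv).ge⟩
  refine ⟨K, hK, le_antisymm ?_ hrank, ?_⟩
  · by_contra! hlt
    have hne : K ≠ ⊥ := by
      rintro rfl
      have h0 := Group.rank_eq_zero (G := (⊥ : Subgroup G))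
      lia
    obtain ⟨M, hMK, hM, hidx⟩ := hK.exists_relIndex_eq hG hA hne
    have h1 := Group.rank_le_rank_add_one_of_index_prime (M := M.subgroupOf K) 
      (show (M.relIndex K).Prime from hidx.symm ▸ hp)
    rw [Group.rank_congr (subgroupOfEquivOfLe hMK)] at h1
    have hKM := hmin ⟨hM, by lia⟩ hMK
    rw [relIndex_eq_one.2 hKM] at hidx
    exact hp.ne_one hidx.symm
  · let := hK.mulDistribMulAction
    intro H hH hne
    rw [Group.rank_congr (H.equivMapOfInjective _ K.subtype_injective)]
    by_contra! hle
    refine hne (top_le_iff.1 fun k _ => ?_)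
    have hinv : AInv A (H.map K.subtype) := by
      rintro a _ ⟨h, hh, rfl⟩
      exact ⟨a • h, hH a h hh, rfl⟩
    obtain ⟨h, hh, hhk⟩ := hmin ⟨hinv, hrank.trans hle⟩ (map_subtype_le H) k.2
    exact K.subtype_injective hhk ▸ hh

end DMax

end

/-- For odd `p` and a finite `p`-group `A` acting on the finite `p`-group `G`, there is an
`A`-invariant subgroup `K` with `d(K) = d(G)`, of nilpotency class at most `2`, and with
`[K,K] = Φ(K)`. -/
theorem stmt7 {p : ℕ} (hp : p.Prime) (hodd : p ≠ 2) {A G : Type*} [Group A] [Finite A]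
    [Group G] [Finite G] [MulDistribMulAction A G]
    (hG : IsPGroup p G) (hA : IsPGroup p A) :
    ∃ K : Subgroup G, AInv A K ∧ Group.rank K = Group.rank G ∧
      lowerCentralSeries K 2 = ⊥ ∧ _root_.commutator K = frattini K := by
  have : Fact p.Prime := ⟨hp⟩
  obtain ⟨K, hK, hrank, hD⟩ := exists_dMax_subgroup_rank_eq hG hA
  let := hK.mulDistribMulAction
  have hGK := hG.to_subgroup K
  refine ⟨K, hK, hrank, ?_, hD.commutator_eq_frattini hGK⟩
  have h : (⊤ : Subgroup K).lowerCentralSeries 2 = ⊥ :=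
    hD.commutator_commutator_eq_bot hGK hA hodd
  change K.lowerCentralSeries 2 = ⊥
  rw [← Subgroup.top_subtype_lowerCentralSeries, h, Subgroup.map_bot]
end

section
/- A finite 2-group G is d-maximal (i.e., d(H) < d(G) for all proper subgroups H) if and only if d(N) < d(G) for all proper normal subgroups N of G. -/
/-- The subgroup generated by the squares of the elements of `H`. For a finite `2`-group this is
the Frattini subgroup of `H`. -/
def sqSubgroup {G : Type*} [Group G] (H : Subgroup G) : Subgroup G :=
  Subgroup.closure ((fun x => x ^ 2) '' (H : Set G))

open scoped commutatorElement

section sqSubgroup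

variable {G : Type*} [Group G]

theorem sq_mem_sqSubgroup {H : Subgroup G} {x : G} (hx : x ∈ H) : x ^ 2 ∈ sqSubgroup H :=
  Subgroup.subset_closure ⟨x, hx, rfl⟩

theorem sqSubgroup_le_iff {H K : Subgroup G} : sqSubgroup H ≤ K ↔ ∀ x ∈ H, x ^ 2 ∈ K := by
  simp [sqSubgroup, Subgroup.closure_le, Set.subset_def]

theorem sqSubgroup_le (H : Subgroup G) : sqSubgroup H ≤ H :=
  sqSubgroup_le_iff.2 fun _ hx => pow_mem hx 2

theorem sqSubgroup_mono {H K : Subgroup G} (h : H ≤ K) : sqSubgroup H ≤ sqSubgroup K :=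
  sqSubgroup_le_iff.2 fun _ hx => sq_mem_sqSubgroup (h hx)

theorem commutatorElement_mem_sqSubgroup {H : Subgroup G} {x y : G} (hx : x ∈ H) (hy : y ∈ H) :
    ⁅x, y⁆ ∈ sqSubgroup H := by
  have h : ⁅x, y⁆ = (x * y) ^ 2 * (y⁻¹ * x⁻¹ * y) ^ 2 * y⁻¹ ^ 2 := by
    simp [commutatorElement_def, pow_two, mul_assoc]
  rw [h]
  exact mul_mem (mul_mem (sq_mem_sqSubgroup (mul_mem hx hy))
    (sq_mem_sqSubgroup (mul_mem (mul_mem (inv_mem hy) (inv_mem hx)) hy)))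
    (sq_mem_sqSubgroup (inv_mem hy))

theorem map_sqSubgroup {G' : Type*} [Group G'] (f : G →* G') (H : Subgroup G) :
    (sqSubgroup H).map f = sqSubgroup (H.map f) := by
  rw [sqSubgroup, MonoidHom.map_closure, sqSubgroup, Subgroup.coe_map, Set.image_image,
    Set.image_image]
  simp only [map_pow]

instance sqSubgroup_normal (H : Subgroup G) [hH : H.Normal] : (sqSubgroup H).Normal := by
  refine ⟨fun n hn g => ?_⟩
  have h : sqSubgroup H ≤ (sqSubgroup H).comap (MulAut.conj g).toMonoidHom := by
    refine sqSubgroup_le_iff.2 fun x hx => ?_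
    have := sq_mem_sqSubgroup (hH.conj_mem x hx g)
    simpa [Subgroup.mem_comap, conj_pow] using this
  simpa using h hn

theorem normal_of_sqSubgroup_top_le {H : Subgroup G} (h : sqSubgroup ⊤ ≤ H) : H.Normal := by
  refine ⟨fun n hn g => ?_⟩
  have := mul_mem (h (commutatorElement_mem_sqSubgroup (Subgroup.mem_top g)
    (Subgroup.mem_top n))) hn
  simpa [commutatorElement_def] using this

end sqSubgroup

section card

variable {G : Type*} [Group G]

theorem card_sup_mul_card_inf (H K : Subgroup G) [K.Normal] :
    Nat.card ↥(H ⊔ K) * Nat.card ↥(H ⊓ K) = Nat.card H * Nat.card K := by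
  have h1 := Subgroup.relIndex_mul_relIndex ⊥ K (H ⊔ K) bot_le le_sup_right
  have h2 := Subgroup.relIndex_mul_relIndex ⊥ (H ⊓ K) H bot_le inf_le_left
  rw [Subgroup.relIndex_sup_right] at h1
  rw [Subgroup.inf_relIndex_left] at h2
  simp only [Subgroup.relIndex_bot_left] at h1 h2
  rw [← h1, ← h2]; ring

theorem index_sqSubgroup_le_two_pow (S : Finset G) :
    (sqSubgroup ⊤).relIndex (Subgroup.closure (S : Set G) ⊔ sqSubgroup ⊤) ≤ 2 ^ S.card := by
  classical
  induction S using Finset.induction_on with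
  | empty => simp
  | insert x S hx ih =>
    set K := Subgroup.closure (S : Set G) ⊔ sqSubgroup ⊤ with hK
    have hKn : K.Normal := normal_of_sqSubgroup_top_le le_sup_right
    have e : Subgroup.closure ((insert x S : Finset G) : Set G) ⊔ sqSubgroup ⊤ =
        Subgroup.zpowers x ⊔ K := by
      rw [Finset.coe_insert, Set.insert_eq, Subgroup.closure_union,
        ← Subgroup.zpowers_eq_closure, hK, sup_assoc]
    have h2 : K.relIndex (Subgroup.zpowers x) ≤ 2 := by
      refine Nat.le_of_dvd two_pos (Subgroup.relIndex_dvd_two_iff.2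
        ⟨x, Subgroup.mem_zpowers x, ?_⟩)
      rintro b ⟨n, rfl⟩
      have hsq : x ^ 2 ∈ K := le_sup_right (a := Subgroup.closure (S : Set G))
        (sq_mem_sqSubgroup (Subgroup.mem_top x))
      rcases Int.even_or_odd' n with ⟨k, rfl | rfl⟩
      · right
        simpa [zpow_mul] using zpow_mem hsq k
      · left
        have : x ^ (2 * k + 1) * x = (x ^ 2) ^ (k + 1) := by
          rw [← zpow_natCast, ← zpow_mul, ← zpow_add_one]; congr 1; push_cast; ring
        simpa [this] using zpow_mem hsq (k + 1)
    rw [← Subgroup.relIndex_sup_right (H := Subgroup.zpowers x), ← e] at h2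
    rw [e, ← Subgroup.relIndex_mul_relIndex _ K _ le_sup_right le_sup_right, ← e,
      Finset.card_insert_of_notMem hx, pow_succ]
    exact Nat.mul_le_mul ih h2

variable [Finite G]

theorem two_mul_card_le_of_lt {H K : Subgroup G} (h : H < K) : 2 * Nat.card H ≤ Nat.card K := by
  obtain ⟨c, hc⟩ := Subgroup.card_dvd_of_le h.le
  have hK : 0 < Nat.card K := Nat.card_pos
  have hne : Nat.card H ≠ Nat.card K := fun e =>
    h.ne (Subgroup.eq_of_le_of_card_ge h.le e.ge)
  rcases c with _ | _ | c
  · simp_all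
  · simp_all
  · rw [hc]; nlinarith [Nat.zero_le (Nat.card H * c)]

theorem card_mul_card_le_card_mul_card_inf {S A B : Subgroup G} (hSA : S ≤ A) (hB : B ≤ A) :
    Nat.card S * Nat.card B ≤ Nat.card A * Nat.card ↥(S ⊓ B) := by
  have h1 := Subgroup.relIndex_mul_relIndex ⊥ B A bot_le hB
  have h2 := Subgroup.relIndex_mul_relIndex ⊥ (S ⊓ B) S bot_le inf_le_left
  rw [Subgroup.inf_relIndex_left] at h2
  have h3 : B.relIndex S ≤ B.relIndex A :=
    Subgroup.relIndex_le_of_le_right hSA fun h => by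
      rw [h, mul_zero, Subgroup.relIndex_bot_left] at h1
      exact Nat.card_pos.ne h1
  simp only [Subgroup.relIndex_bot_left] at h1 h2
  rw [← h1, ← h2]
  nlinarith [Nat.mul_le_mul_left (Nat.card B * Nat.card ↥(S ⊓ B)) h3]

theorem exists_finset_two_pow_le :
    ∃ S : Finset G, Subgroup.closure (S : Set G) ⊔ sqSubgroup ⊤ = ⊤ ∧
      2 ^ S.card ≤ (sqSubgroup (⊤ : Subgroup G)).index := by
  classical
  have := Fintype.ofFinite G
  let P : Set (Finset G) := {S | 2 ^ S.card * Nat.card (sqSubgroup (⊤ : Subgroup G)) ≤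
    Nat.card ↥(Subgroup.closure (S : Set G) ⊔ sqSubgroup ⊤)}
  have hP : P.Nonempty := ⟨∅, by simp [P]⟩
  obtain ⟨S, hS, hmax⟩ := Set.exists_max_image P Finset.card P.toFinite hP
  have htop : Subgroup.closure (S : Set G) ⊔ sqSubgroup ⊤ = ⊤ := by
    by_contra hne
    obtain ⟨x, hx⟩ : ∃ x, x ∉ Subgroup.closure (S : Set G) ⊔ sqSubgroup ⊤ := by
      by_contra! h
      exact hne (eq_top_iff.2 fun x _ => h x)
    have hxS : x ∉ S := fun h => hx (Subgroup.mem_sup_left (Subgroup.subset_closure h))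
    have hlt : Subgroup.closure (S : Set G) ⊔ sqSubgroup ⊤ <
        Subgroup.closure ((insert x S : Finset G) : Set G) ⊔ sqSubgroup ⊤ := by
      refine lt_of_le_of_ne (sup_le_sup_right (Subgroup.closure_mono (by simp)) _) fun e => hx ?_
      rw [e]
      exact Subgroup.mem_sup_left (Subgroup.subset_closure (by simp))
    have h := hmax (insert x S) (by
      have := two_mul_card_le_of_lt hlt
      simp only [P, Set.mem_ofPred_eq] at hS ⊢
      rw [Finset.card_insert_of_notMem hxS, pow_succ]
      linarith)
    rw [Finset.card_insert_of_notMem hxS] at h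
    omega
  refine ⟨S, htop, ?_⟩
  simp only [P, Set.mem_ofPred_eq] at hS
  rw [htop, Subgroup.card_top, ← Subgroup.index_mul_card (sqSubgroup (⊤ : Subgroup G))] at hS
  exact Nat.le_of_mul_le_mul_right hS Nat.card_pos

theorem IsPGroup.sqSubgroup_top_le_frattini (hG : IsPGroup 2 G) : sqSubgroup ⊤ ≤ frattini G := by
  rw [frattini, Order.radical]
  refine le_iInf₂ fun M hM => sqSubgroup_le_iff.2 fun x _ => ?_
  have : Fact (Nat.Prime 2) := ⟨Nat.prime_two⟩
  obtain ⟨n, hn⟩ := IsPGroup.iff_card.1 hG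
  obtain ⟨m, hm⟩ := IsPGroup.iff_card.1 (hG.to_subgroup M)
  have hlt : m < n := by
    have := two_mul_card_le_of_lt (lt_top_iff_ne_top.2 hM.1)
    rw [Subgroup.card_top, hm, hn, ← pow_succ', Nat.pow_le_pow_iff_right (by norm_num)] at this
    omega
  obtain ⟨K, hK, hMK⟩ := Sylow.exists_subgroup_card_pow_succ (p := 2)
    (hn ▸ pow_dvd_pow 2 (Nat.succ_le_of_lt hlt)) hm
  have hKtop : K = ⊤ := hM.2 K (lt_of_le_of_ne hMK (by
    rintro rfl
    rw [hm] at hK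
    exact absurd (Nat.pow_right_injective le_rfl hK) (by omega)))
  have hidx : M.index = 2 := by
    have := M.index_mul_card
    rw [← Subgroup.card_top (G := G), ← hKtop, hK, hm, pow_succ'] at this
    exact Nat.eq_of_mul_eq_mul_right (by positivity) this
  exact Subgroup.sq_mem_of_index_two hidx x

/-- The Burnside basis theorem for finite `2`-groups. -/
theorem IsPGroup.index_sqSubgroup_top (hG : IsPGroup 2 G) :
    (sqSubgroup (⊤ : Subgroup G)).index = 2 ^ Group.rank G := by
  apply le_antisymm
  · obtain ⟨S, hS, hcl⟩ := Group.rank_spec (G := G)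
    have := index_sqSubgroup_le_two_pow S
    rwa [hcl, top_sup_eq, Subgroup.relIndex_top_right, hS] at this
  · obtain ⟨S, hS, hle⟩ := exists_finset_two_pow_le (G := G)
    have hcl : Subgroup.closure (S : Set G) = ⊤ :=
      frattini_nongenerating (top_le_iff.1
        (hS.ge.trans (sup_le_sup_left hG.sqSubgroup_top_le_frattini _)))
    exact (Nat.pow_le_pow_right two_pos (Group.rank_le hcl)).trans hle

theorem IsPGroup.card_eq_two_pow_rank_mul (hG : IsPGroup 2 G) (H : Subgroup G) :
    Nat.card H = 2 ^ Group.rank H * Nat.card (sqSubgroup H) := by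
  have h := (hG.to_subgroup H).index_sqSubgroup_top
  have h2 := (sqSubgroup (⊤ : Subgroup H)).index_mul_card
  have h3 : Nat.card (sqSubgroup (⊤ : Subgroup H)) = Nat.card (sqSubgroup H) := by
    rw [← Subgroup.card_map_of_injective (f := H.subtype) H.subtype_injective,
      map_sqSubgroup]
    rw [← MonoidHom.range_eq_map, Subgroup.range_subtype]
  rw [← h2, h, h3]

end card

section commutator

variable {G : Type*} [Group G]

theorem commutatorElement_mem_of_mem_closure {S : Set G} {W : Subgroup G} [hW : W.Normal] {b : G}
    (h : ∀ s ∈ S, ⁅s, b⁆ ∈ W) {x : G} (hx : x ∈ Subgroup.closure S) : ⁅x, b⁆ ∈ W := by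
  induction hx using Subgroup.closure_induction with
  | mem x hx => exact h x hx
  | one => simp
  | mul x y _ _ hx hy =>
    rw [commutatorElement_mul_left_eq_conj_mul]
    exact mul_mem (hW.conj_mem _ hy x) hx
  | inv x _ hx =>
    rw [commutatorElement_inv_left, ← commutatorElement_inv]
    simpa using hW.conj_mem _ (inv_mem hx) x⁻¹

theorem le_of_le_sup_commutator_top [Group.IsNilpotent G] {W N : Subgroup G} [W.Normal]
    (h : N ≤ W ⊔ ⁅N, (⊤ : Subgroup G)⁆) : N ≤ W := by
  obtain ⟨n, hn⟩ := Subgroup.nilpotent_iff_lowerCentralSeries.1 ‹Group.IsNilpotent G›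
  have key : ∀ k, N ≤ W ⊔ (⊤ : Subgroup G).lowerCentralSeries k := by
    intro k
    induction k with
    | zero => simp
    | succ k ih =>
      refine h.trans (sup_le le_sup_left (Subgroup.commutator_le.2 fun x hx g _ => ?_))
      have hx' := ih hx
      rw [Subgroup.sup_eq_closure] at hx'
      refine commutatorElement_mem_of_mem_closure ?_ hx'
      rintro s (hs | hs)
      · exact Subgroup.mem_sup_left (Subgroup.commutator_le_left W ⊤
          (Subgroup.commutator_mem_commutator hs (Subgroup.mem_top g)))
      · exact Subgroup.mem_sup_right (Subgroup.commutator_mem_commutator hs (Subgroup.mem_top g))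
  simpa [hn] using key n

theorem commutatorElement_sq_right_mem {W : Subgroup G} [hW : W.Normal] {b g : G}
    (h : ⁅b, g⁆ ^ 2 ∈ W) (h' : ⁅⁅b, g⁆, g⁆ ∈ W) : ⁅b, g ^ 2⁆ ∈ W := by
  have e : ⁅b, g ^ 2⁆ = (⁅b, g⁆ * ⁅⁅b, g⁆, g⁆⁻¹ * ⁅b, g⁆⁻¹) * ⁅b, g⁆ ^ 2 := by
    simp [commutatorElement_def, pow_two, mul_assoc]
  rw [e]
  exact mul_mem (hW.conj_mem _ (inv_mem h') _) h

theorem commutatorElement_mem_of_forall_sq {W : Subgroup G} [hW : W.Normal] {b : G}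
    (h : ∀ g, ⁅b, g ^ 2⁆ ∈ W) {f : G} (hf : f ∈ sqSubgroup (⊤ : Subgroup G)) : ⁅b, f⁆ ∈ W := by
  rw [← inv_mem_iff, commutatorElement_inv]
  refine commutatorElement_mem_of_mem_closure ?_ hf
  rintro _ ⟨g, -, rfl⟩
  rw [← inv_mem_iff, commutatorElement_inv]
  exact h g

theorem commutator_sqSubgroup_top_le [Group.IsNilpotent G] {A : Subgroup G} [A.Normal]
    (hA : A ≤ sqSubgroup ⊤) (h : ⁅A, (⊤ : Subgroup G)⁆ ≤ sqSubgroup A) :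
    ⁅sqSubgroup A, (⊤ : Subgroup G)⁆ ≤ sqSubgroup (sqSubgroup A) := by
  have hB : ∀ {b g}, b ∈ sqSubgroup A → ⁅b, g⁆ ∈ sqSubgroup A := fun hb =>
    Subgroup.commutator_le_left (sqSubgroup A) ⊤
      (Subgroup.commutator_mem_commutator hb (Subgroup.mem_top _))
  refine le_of_le_sup_commutator_top ?_
  set W := sqSubgroup (sqSubgroup A) ⊔ ⁅⁅sqSubgroup A, (⊤ : Subgroup G)⁆, (⊤ : Subgroup G)⁆
  have hBF : ∀ b ∈ sqSubgroup A, ∀ f ∈ sqSubgroup (⊤ : Subgroup G), ⁅b, f⁆ ∈ W := fun b hb f hf =>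
    commutatorElement_mem_of_forall_sq (fun g => commutatorElement_sq_right_mem
      (Subgroup.mem_sup_left (sq_mem_sqSubgroup (hB hb)))
      (Subgroup.mem_sup_right (Subgroup.commutator_mem_commutator
        (Subgroup.commutator_mem_commutator hb (Subgroup.mem_top g)) (Subgroup.mem_top g)))) hf
  refine Subgroup.commutator_le.2 fun x hx g _ => ?_
  refine commutatorElement_mem_of_mem_closure ?_ hx
  rintro _ ⟨a, ha, rfl⟩
  have hy : ⁅a, g⁆ ∈ sqSubgroup A :=
    h (Subgroup.commutator_mem_commutator ha (Subgroup.mem_top g))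
  have e : ⁅a ^ 2, g⁆ = ⁅⁅a, g⁆, a⁆⁻¹ * ⁅a, g⁆ ^ 2 := by
    simp [commutatorElement_def, pow_two, mul_assoc]
  change ⁅a ^ 2, g⁆ ∈ W
  rw [e]
  exact mul_mem (inv_mem (hBF _ hy a (hA ha))) (Subgroup.mem_sup_left (sq_mem_sqSubgroup hy))

theorem commutatorElement_mem_sqSubgroup_sqSubgroup [Group.IsNilpotent G] {A : Subgroup G}
    [A.Normal] (hA : A ≤ sqSubgroup ⊤) (h : ⁅A, (⊤ : Subgroup G)⁆ ≤ sqSubgroup A) {a f : G}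
    (ha : a ∈ A) (hf : f ∈ sqSubgroup (⊤ : Subgroup G)) : ⁅a, f⁆ ∈ sqSubgroup (sqSubgroup A) := by
  refine commutatorElement_mem_of_forall_sq (fun g => ?_) hf
  have hy : ⁅a, g⁆ ∈ sqSubgroup A :=
    h (Subgroup.commutator_mem_commutator ha (Subgroup.mem_top g))
  exact commutatorElement_sq_right_mem (sq_mem_sqSubgroup hy)
    (commutator_sqSubgroup_top_le hA h
      (Subgroup.commutator_mem_commutator hy (Subgroup.mem_top g)))

end commutator

section powerful

variable {G : Type*} [Group G]

/-- If `A` is commutative modulo `X`, then squaring is a homomorphism `A → G ⧸ X`; the theorem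
provides its kernel `K` and counts each `S ≤ A` along it. -/
theorem exists_card_eq_card_inf_mul_card_map (A X : Subgroup G) [X.Normal]
    (h : ∀ a ∈ A, ∀ b ∈ A, ⁅a, b⁆ ∈ X) :
    ∃ K ≤ A, (∀ a ∈ A, a ∈ K ↔ a ^ 2 ∈ X) ∧ ∀ S ≤ A, Nat.card S =
      Nat.card ↥(S ⊓ K) * Nat.card ↥((sqSubgroup S).map (QuotientGroup.mk' X)) := by
  let f : A →* G ⧸ X :=
    { toFun := fun a => QuotientGroup.mk' X ((a : G) ^ 2)
      map_one' := by simp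
      map_mul' := fun a b => by
        have e : ((a * b : A) : G) ^ 2 = (a : G) ^ 2 * ⁅(a : G)⁻¹, (b : G)⁆ * (b : G) ^ 2 := by
          simp [commutatorElement_def, pow_two, mul_assoc]
        have h1 : QuotientGroup.mk' X ⁅(a : G)⁻¹, (b : G)⁆ = 1 :=
          (QuotientGroup.eq_one_iff _).2 (h _ (inv_mem a.2) _ b.2)
        rw [e, map_mul, map_mul, h1, mul_one] }
  have hf : ∀ a : A, f a = 1 ↔ (a : G) ^ 2 ∈ X := fun a =>
    QuotientGroup.eq_one_iff (N := X) ((a : G) ^ 2)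
  refine ⟨f.ker.map A.subtype, Subgroup.map_subtype_le _, fun a ha => ?_, fun S hS => ?_⟩
  · rw [← hf ⟨a, ha⟩]
    simp [Subgroup.mem_map, ha, MonoidHom.mem_ker]
  · have hmap : (S.subgroupOf A).map A.subtype = S := by simpa using hS
    have h1 : (S.subgroupOf A).map f = (sqSubgroup S).map (QuotientGroup.mk' X) := by
      apply le_antisymm
      · rintro _ ⟨a, ha, rfl⟩
        exact ⟨(a : G) ^ 2, sq_mem_sqSubgroup ha, rfl⟩
      · rw [Subgroup.map_le_iff_le_comap]
        refine sqSubgroup_le_iff.2 fun x hx => ?_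
        exact ⟨⟨x, hS hx⟩, hx, rfl⟩
    have hcard (T : Subgroup A) : Nat.card (T.map A.subtype) = Nat.card T :=
      Subgroup.card_map_of_injective A.subtype_injective
    have h2 := Subgroup.relIndex_mul_relIndex ⊥ (S.subgroupOf A ⊓ f.ker) (S.subgroupOf A) bot_le
      inf_le_left
    rw [Subgroup.inf_relIndex_left, Subgroup.relIndex_ker, h1, Subgroup.relIndex_bot_left,
      Subgroup.relIndex_bot_left,
      ← hcard, ← hcard, Subgroup.map_inf _ _ _ A.subtype_injective, hmap] at h2
    exact h2.symm

theorem card_map_mk_mul_card_inf (B X : Subgroup G) [X.Normal] :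
    Nat.card ↥(B.map (QuotientGroup.mk' X)) * Nat.card ↥(B ⊓ X) = Nat.card B := by
  have h := Subgroup.relIndex_ker (QuotientGroup.mk' X) (K := B)
  have h2 := Subgroup.relIndex_mul_relIndex ⊥ (B ⊓ X) B bot_le inf_le_left
  rw [Subgroup.inf_relIndex_left] at h2
  rw [QuotientGroup.ker_mk'] at h
  rw [← h, mul_comm]
  simpa using h2

variable [Finite G]

theorem IsPGroup.sqSubgroup_lt (hG : IsPGroup 2 G) {A : Subgroup G} (hA : A ≠ ⊥) :
    sqSubgroup A < A := by
  refine lt_of_le_of_ne (sqSubgroup_le A) fun e => hA ?_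
  have h := hG.card_eq_two_pow_rank_mul A
  rw [e] at h
  have h1 : 2 ^ Group.rank A = 1 := by
    have : 0 < Nat.card A := Nat.card_pos
    nlinarith
  have h2 : Group.rank A = 0 := by simpa using h1
  have := Group.rank_eq_zero_iff.1 h2
  exact A.eq_bot_of_subsingleton

theorem IsPGroup.card_mul_card_sqSubgroup_le (hG : IsPGroup 2 G) (A : Subgroup G) [A.Normal]
    (hA : A ≤ sqSubgroup ⊤) (h : ⁅A, (⊤ : Subgroup G)⁆ ≤ sqSubgroup A) {S : Subgroup G}
    (hS : S ≤ A) :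
    Nat.card S * Nat.card (sqSubgroup A) ≤ Nat.card A * Nat.card (sqSubgroup S) := by
  have : Fact (Nat.Prime 2) := ⟨Nat.prime_two⟩
  have : Group.IsNilpotent G := hG.isNilpotent
  induction hn : Nat.card A using Nat.strong_induction_on generalizing A S with
  | _ n ih =>
  rcases eq_or_ne A ⊥ with rfl | hne
  · obtain rfl : S = ⊥ := le_bot_iff.1 hS
    rw [← hn]
  have hlt := hG.sqSubgroup_lt hne
  have hlt' : Nat.card (sqSubgroup A) < n := by
    have := two_mul_card_le_of_lt hlt
    have : 0 < Nat.card (sqSubgroup A) := Nat.card_pos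
    omega
  set B := sqSubgroup A with hB
  have ih' := ih _ hlt' B (hlt.le.trans hA) (commutator_sqSubgroup_top_le hA h)
    (inf_le_right : S ⊓ B ≤ B) rfl
  set X := sqSubgroup B with hX
  obtain ⟨K, hKA, hK, hcard⟩ := exists_card_eq_card_inf_mul_card_map A X fun a ha b hb =>
    commutatorElement_mem_sqSubgroup_sqSubgroup hA h ha (hA hb)
  have hBK : B ≤ K := fun b hb => (hK b (hlt.le hb)).2 (sq_mem_sqSubgroup hb)
  have h1 := hcard S hS
  have h2 := hcard A le_rfl
  rw [inf_eq_right.2 hKA] at h2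
  have h3 := card_map_mk_mul_card_inf B X
  rw [inf_eq_right.2 (sqSubgroup_le B)] at h3
  have h4 := card_map_mk_mul_card_inf (sqSubgroup S) X
  have h5 : Nat.card (sqSubgroup (S ⊓ B)) ≤ Nat.card ↥(sqSubgroup S ⊓ X) :=
    Nat.card_mono (Set.toFinite _)
      (le_inf (sqSubgroup_mono inf_le_left) (sqSubgroup_mono inf_le_right))
  have h6 := card_mul_card_le_card_mul_card_inf (S := S ⊓ K) (A := K) inf_le_right hBK
  rw [inf_assoc, inf_eq_right.2 hBK] at h6
  rw [← hn, h1, h2, ← h4]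
  rw [← hB]
  generalize Nat.card ↥((sqSubgroup S).map (QuotientGroup.mk' X)) = s at *
  generalize Nat.card ↥(B.map (QuotientGroup.mk' X)) = β at *
  have hx : 0 < Nat.card X := Nat.card_pos
  generalize Nat.card X = x at *
  generalize Nat.card K = k at *
  generalize Nat.card ↥(S ⊓ K) = sk at *
  generalize Nat.card ↥(S ⊓ B) = t at *
  generalize Nat.card ↥(sqSubgroup S ⊓ X) = u at *
  generalize Nat.card ↥(sqSubgroup (S ⊓ B)) = v at *
  rw [← h3] at ih' h6 ⊢
  have h7 : t ≤ β * v := Nat.le_of_mul_le_mul_right (by linarith) hx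
  calc sk * s * (β * x) = s * (sk * (β * x)) := by ring
    _ ≤ s * (k * t) := Nat.mul_le_mul_left _ h6
    _ ≤ s * (k * (β * u)) := by gcongr; exact h7.trans (Nat.mul_le_mul_left _ h5)
    _ = k * β * (s * u) := by ring

end powerful

section monolith

variable {G : Type*} [Group G]

theorem index_centralizer_singleton_le_two {z f : G} (hz : z ∈ Subgroup.center G) (hz2 : z ^ 2 = 1)
    (hf : ∀ g : G, ⁅g, f⁆ = 1 ∨ ⁅g, f⁆ = z) : (Subgroup.centralizer {f}).index ≤ 2 := by
  have hmem : ∀ g, g ∈ Subgroup.centralizer {f} ↔ ⁅g, f⁆ = 1 := fun g => by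
    rw [Subgroup.mem_centralizer_singleton_iff, commutatorElement_eq_one_iff_mul_comm]
  refine Nat.le_of_dvd two_pos (Subgroup.index_dvd_two_iff.2 ?_)
  by_cases h : ∃ a : G, ⁅a, f⁆ = z
  · obtain ⟨a, ha⟩ := h
    refine ⟨a, fun b => ?_⟩
    rcases hf b with hb | hb
    · exact Or.inr ((hmem b).2 hb)
    · left
      rw [hmem, commutatorElement_mul_left_eq_conj_mul, ha, hb, Subgroup.mem_center_iff.1 hz b]
      simp [← pow_two, hz2]
  · refine ⟨1, fun b => Or.inr ((hmem b).2 ((hf b).resolve_right fun hb => h ⟨b, hb⟩))⟩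

variable [Finite G]

theorem IsPGroup.exists_sq_eq_one_of_ne_bot (hG : IsPGroup 2 G) {N : Subgroup G} (hN : N ≠ ⊥) :
    ∃ z ∈ N, z ^ 2 = 1 ∧ z ≠ 1 := by
  have : Fact (Nat.Prime 2) := ⟨Nat.prime_two⟩
  have hdvd : 2 ∣ Nat.card N :=
    (hG.to_subgroup N).card_eq_or_dvd.resolve_left fun h => hN (Subgroup.card_eq_one.1 h)
  obtain ⟨z, hz⟩ := exists_prime_orderOf_dvd_card' 2 hdvd
  obtain ⟨h1, h2⟩ := orderOf_eq_prime_iff.1 hz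
  exact ⟨z, z.2, by exact_mod_cast congrArg Subtype.val h1, fun h => h2 (Subtype.ext h)⟩

theorem IsPGroup.card_mul_card_sqSubgroup_centralizer_le (hG : IsPGroup 2 G) (F : Subgroup G)
    [F.Normal] (hF : sqSubgroup ⊤ ≤ F) (hF2 : sqSubgroup F = ⊥) (hne : ⁅F, (⊤ : Subgroup G)⁆ ≠ ⊥)
    (hmin : ∀ N : Subgroup G, N.Normal → N ≤ F → N ≠ ⊥ → ⁅F, (⊤ : Subgroup G)⁆ ≤ N) :
    Nat.card G * Nat.card (sqSubgroup (Subgroup.centralizer (F : Set G))) ≤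
      Nat.card F * Nat.card (Subgroup.centralizer (F : Set G)) := by
  have hRF : ⁅F, (⊤ : Subgroup G)⁆ ≤ F := Subgroup.commutator_le_left F ⊤
  have hRc : ⁅F, (⊤ : Subgroup G)⁆ ≤ Subgroup.center G := by
    have : Fact (Nat.Prime 2) := ⟨Nat.prime_two⟩
    have : Group.IsNilpotent G := hG.isNilpotent
    rw [← Subgroup.commutator_top_right_eq_bot_iff_le_center]
    by_contra hc
    refine hne (le_bot_iff.1 (le_of_le_sup_commutator_top ?_))
    rw [bot_sup_eq]
    exact hmin _ inferInstance ((Subgroup.commutator_le_left _ _).trans hRF) hc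
  obtain ⟨z, hzR, hz2, hz1⟩ := hG.exists_sq_eq_one_of_ne_bot hne
  have hzc := hRc hzR
  have hzpow : ∀ {w : G}, w ^ 2 = 1 → ∀ x ∈ Subgroup.zpowers w, x = 1 ∨ x = w := by
    rintro w hw _ ⟨n, rfl⟩
    rcases Int.even_or_odd' n with ⟨k, rfl | rfl⟩
    · left
      have : w ^ (2 : ℤ) = 1 := by exact_mod_cast hw
      simp [zpow_mul, this]
    · right
      have : w ^ (2 : ℤ) = 1 := by exact_mod_cast hw
      simp [zpow_add, zpow_mul, this]
  have hR : ∀ w ∈ F, w ∈ Subgroup.center G → w ≠ 1 → ∀ x ∈ ⁅F, (⊤ : Subgroup G)⁆,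
      x = 1 ∨ x = w := by
    intro w hw hwc hw1 x hx
    have hw2 : w ^ 2 = 1 := by
      have := sq_mem_sqSubgroup hw
      rwa [hF2, Subgroup.mem_bot] at this
    refine hzpow hw2 x (hmin _ ⟨?_⟩ (by simpa using hw) (by simpa using hw1) hx)
    intro n hn g
    have : n ∈ Subgroup.center G := (Subgroup.zpowers_le.2 hwc) hn
    rwa [Subgroup.mem_center_iff.1 this g, mul_inv_cancel_right]
  have hZ : F ⊓ Subgroup.center G ≤ Subgroup.zpowers z := by
    rintro w ⟨hw, hwc⟩
    by_cases hw1 : w = 1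
    · rw [hw1]; exact one_mem _
    · rw [← (hR w hw hwc hw1 z hzR).resolve_left hz1]
      exact Subgroup.mem_zpowers z
  have hzcard : Nat.card (Subgroup.zpowers z) = 2 := by
    rw [Nat.card_zpowers]
    exact orderOf_eq_prime hz2 hz1
  have hcomm : ∀ f ∈ F, ∀ g : G, ⁅g, f⁆ = 1 ∨ ⁅g, f⁆ = z := by
    intro f hf g
    refine hR z (hRF hzR) hzc hz1 _ ?_
    rw [Subgroup.commutator_comm]
    exact Subgroup.commutator_mem_commutator (Subgroup.mem_top g) hf
  -- Squares of elements centralizing `F` are central.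
  have hC : sqSubgroup (Subgroup.centralizer (F : Set G)) ≤ Subgroup.zpowers z := by
    refine le_trans (sqSubgroup_le_iff.2 fun c hc => Subgroup.mem_inf.2 ⟨?_, ?_⟩) hZ
    · exact hF (sq_mem_sqSubgroup (Subgroup.mem_top c))
    · refine Subgroup.mem_center_iff.2 fun g => ?_
      have ht : ⁅g, c⁆ ∈ F := hF (commutatorElement_mem_sqSubgroup (Subgroup.mem_top g)
        (Subgroup.mem_top c))
      have ht2 : ⁅g, c⁆ ^ 2 = 1 := by
        have := sq_mem_sqSubgroup ht
        rwa [hF2, Subgroup.mem_bot] at this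
      have hct : Commute ⁅g, c⁆ c := Subgroup.mem_centralizer_iff.1 hc _ ht
      have e : g * c ^ 2 * g⁻¹ = (⁅g, c⁆ * c) ^ 2 := by
        simp [commutatorElement_def, pow_two, mul_assoc]
      rw [hct.mul_pow, ht2, one_mul] at e
      rw [← e, inv_mul_cancel_right, e]
  have hCcard : Nat.card (sqSubgroup (Subgroup.centralizer (F : Set G))) ≤ 2 :=
    hzcard ▸ Nat.card_mono (Set.toFinite _) hC
  have hindex : 2 * (Subgroup.centralizer (F : Set G)).index ≤ Nat.card F := by
    let P : Set (Subgroup G) := {E | E ≤ F ∧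
      2 * (Subgroup.centralizer (E : Set G)).index ≤ Nat.card E}
    have hP : Subgroup.zpowers z ∈ P := by
      refine ⟨by simpa using hRF hzR, ?_⟩
      have : Subgroup.centralizer (Subgroup.zpowers z : Set G) = ⊤ := by
        rw [Subgroup.centralizer_eq_top_iff_subset]
        exact Subgroup.zpowers_le.2 hzc
      rw [this, hzcard, Subgroup.index_top]
    obtain ⟨E, hE⟩ := P.toFinite.exists_maximal ⟨_, hP⟩
    obtain ⟨hEF, hEc⟩ := hE.prop
    rcases hEF.eq_or_lt with rfl | hlt
    · exact hEc
    obtain ⟨f, hf, hfE⟩ := SetLike.exists_of_lt hlt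
    have hlt' : E < E ⊔ Subgroup.zpowers f := left_lt_sup.2 (by simpa using hfE)
    refine absurd (hE.le_of_ge (y := E ⊔ Subgroup.zpowers f) ⟨?_, ?_⟩ hlt'.le) hlt'.not_ge
    · exact sup_le hEF (by simpa using hf)
    · have hle : Subgroup.centralizer (E : Set G) ⊓ Subgroup.centralizer {f} ≤
          Subgroup.centralizer ((E ⊔ Subgroup.zpowers f : Subgroup G) : Set G) := by
        rw [Subgroup.le_centralizer_iff]
        refine sup_le ?_ (Subgroup.zpowers_le.2 ?_)
        · rw [Subgroup.le_centralizer_iff]; exact inf_le_left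
        · rw [Subgroup.mem_centralizer_iff]
          intro h hh
          exact (Subgroup.mem_centralizer_singleton_iff.1 hh.2)
      have h1 := Subgroup.index_antitone hle
      have h2 := Subgroup.index_inf_le (H := Subgroup.centralizer (E : Set G))
        (K := Subgroup.centralizer {f})
      have h3 := index_centralizer_singleton_le_two hzc hz2 (hcomm f hf)
      have h4 := two_mul_card_le_of_lt hlt'
      nlinarith [Nat.mul_le_mul_left (Subgroup.centralizer (E : Set G)).index h3]
  have hmul := (Subgroup.centralizer (F : Set G)).index_mul_card
  rw [← hmul]
  calc _ ≤ (Subgroup.centralizer (F : Set G)).index *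
        Nat.card (Subgroup.centralizer (F : Set G)) * 2 := Nat.mul_le_mul_left _ hCcard
    _ = 2 * (Subgroup.centralizer (F : Set G)).index *
        Nat.card (Subgroup.centralizer (F : Set G)) := by ring
    _ ≤ _ := Nat.mul_le_mul_right _ hindex

end monolith

section dMaximal

variable {G : Type*} [Group G] [Finite G]

theorem IsPGroup.commutator_sqSubgroup_top_le_of_rank_lt (hG : IsPGroup 2 G)
    (h : ∀ N : Subgroup G, N.Normal → N ≠ ⊤ → Group.rank N < Group.rank G) :
    ⁅sqSubgroup (⊤ : Subgroup G), (⊤ : Subgroup G)⁆ ≤ sqSubgroup (sqSubgroup ⊤) := by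
  by_contra hcon
  set F := sqSubgroup (⊤ : Subgroup G) with hF
  let P : Set (Subgroup G) := {J | J.Normal ∧ J ≤ F ∧ sqSubgroup F ≤ J ∧
    ¬ ⁅F, (⊤ : Subgroup G)⁆ ≤ J}
  have hP : sqSubgroup F ∈ P := ⟨inferInstance, sqSubgroup_le F, le_rfl, hcon⟩
  obtain ⟨J, hJ⟩ := P.toFinite.exists_maximal ⟨_, hP⟩
  obtain ⟨hJn, hJF, hFJ, hJc⟩ := hJ.prop
  set π := QuotientGroup.mk' J with hπ
  have hsurj : Function.Surjective π := QuotientGroup.mk'_surjective J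
  have hker : π.ker = J := QuotientGroup.ker_mk' J
  have htop : (⊤ : Subgroup G).map π = ⊤ := Subgroup.map_top_of_surjective π hsurj
  have hFmap : F.map π = sqSubgroup ⊤ := by rw [hF, map_sqSubgroup, htop]
  have hcmap : ⁅F.map π, (⊤ : Subgroup (G ⧸ J))⁆ = ⁅F, (⊤ : Subgroup G)⁆.map π := by
    rw [Subgroup.map_commutator, htop]
  have hFn : (F.map π).Normal := by rw [hFmap]; infer_instance
  have hne : ⁅F.map π, (⊤ : Subgroup (G ⧸ J))⁆ ≠ ⊥ := by
    rw [hcmap, Ne, Subgroup.map_eq_bot_iff, hker]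
    exact hJc
  have hcard := (hG.to_quotient J).card_mul_card_sqSubgroup_centralizer_le (F.map π) hFmap.ge
    (by rw [← map_sqSubgroup, Subgroup.map_eq_bot_iff, hker]; exact hFJ) hne (by
      intro N hN hNF hNb
      rw [hcmap, Subgroup.map_le_iff_le_comap]
      by_contra hc
      have hJN : J ≤ N.comap π := hker.ge.trans (π.ker_le_comap N)
      have hle : N.comap π ≤ J := hJ.le_of_ge ⟨hN.comap π, by
        have := Subgroup.comap_mono (f := π) hNF
        rwa [Subgroup.comap_map_eq, hker, sup_eq_left.2 hJF] at this, hFJ.trans hJN, hc⟩ hJN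
      apply hNb
      rw [← Subgroup.map_comap_eq_self_of_surjective hsurj N, Subgroup.map_eq_bot_iff, hker]
      exact hle)
  set C := Subgroup.centralizer (F.map π : Set (G ⧸ J)) with hC
  have hCn : C.Normal := Subgroup.normal_centralizer
  have hCtop : C.comap π ≠ ⊤ := by
    intro hc
    apply hne
    rw [Subgroup.commutator_eq_bot_iff_le_centralizer, Subgroup.le_centralizer_iff, ← htop,
      Subgroup.map_le_iff_le_comap]
    exact hc.ge
  have hrank := h _ (hCn.comap π) hCtop
  have hCrank : Group.rank C ≤ Group.rank (C.comap π) :=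
    Group.rank_le_of_surjective (π.subgroupComap C)
      (π.subgroupComap_surjective_of_surjective C hsurj)
  have hidx : (F.map π).index = 2 ^ Group.rank G := by
    rw [Subgroup.index_map_eq _ hsurj (hker.le.trans hJF), hF, hG.index_sqSubgroup_top]
  rw [← (F.map π).index_mul_card, hidx, (hG.to_quotient J).card_eq_two_pow_rank_mul C] at hcard
  have hpos : 0 < Nat.card (F.map π) * Nat.card (sqSubgroup C) :=
    Nat.mul_pos Nat.card_pos Nat.card_pos
  have h2 : 2 ^ Group.rank G ≤ 2 ^ Group.rank C :=
    Nat.le_of_mul_le_mul_right (by linarith) hpos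
  rw [Nat.pow_le_pow_iff_right (by norm_num)] at h2
  omega

theorem IsPGroup.rank_le_rank_sup (hG : IsPGroup 2 G)
    (h : ⁅sqSubgroup (⊤ : Subgroup G), (⊤ : Subgroup G)⁆ ≤ sqSubgroup (sqSubgroup ⊤))
    (H : Subgroup G) :
    Group.rank H ≤ Group.rank ↥(H ⊔ sqSubgroup ⊤) := by
  set F := sqSubgroup (⊤ : Subgroup G) with hF
  have hN : sqSubgroup (H ⊔ F) ≤ sqSubgroup H ⊔ sqSubgroup F := by
    refine sqSubgroup_le_iff.2 fun x hx => ?_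
    obtain ⟨a, ha, f, hf, rfl⟩ := Subgroup.mem_sup_of_normal_right.1 hx
    have e : (a * f) ^ 2 = a ^ 2 * (⁅f, a⁻¹⁆⁻¹ * f ^ 2) := by
      simp [commutatorElement_def, pow_two, mul_assoc]
    rw [e]
    exact mul_mem (Subgroup.mem_sup_left (sq_mem_sqSubgroup ha)) (Subgroup.mem_sup_right
      (mul_mem (inv_mem (h (Subgroup.commutator_mem_commutator hf (Subgroup.mem_top _))))
        (sq_mem_sqSubgroup hf)))
  have h1 := card_sup_mul_card_inf H F
  have h2 := card_sup_mul_card_inf (sqSubgroup H) (sqSubgroup F)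
  have h3 : Nat.card (sqSubgroup (H ⊔ F)) ≤ Nat.card ↥(sqSubgroup H ⊔ sqSubgroup F) :=
    Nat.card_mono (Set.toFinite _) hN
  have h4 := hG.card_mul_card_sqSubgroup_le F le_rfl h (inf_le_right : H ⊓ F ≤ F)
  have h5 : Nat.card (sqSubgroup (H ⊓ F)) ≤ Nat.card ↥(sqSubgroup H ⊓ sqSubgroup F) :=
    Nat.card_mono (Set.toFinite _)
      (le_inf (sqSubgroup_mono inf_le_left) (sqSubgroup_mono inf_le_right))
  have h6 := hG.card_eq_two_pow_rank_mul H
  have h7 := hG.card_eq_two_pow_rank_mul (H ⊔ F)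
  have hs : 0 < Nat.card ↥(H ⊓ F) := Nat.card_pos
  have hi : 0 < Nat.card ↥(sqSubgroup H ⊓ sqSubgroup F) := Nat.card_pos
  have hh : 0 < Nat.card (sqSubgroup H) := Nat.card_pos
  have hn : 0 < Nat.card (sqSubgroup (H ⊔ F)) := Nat.card_pos
  rw [← Nat.pow_le_pow_iff_right (a := 2) (by norm_num)]
  generalize 2 ^ Group.rank H = r at *
  generalize 2 ^ Group.rank ↥(H ⊔ F) = r' at *
  generalize Nat.card ↥(H ⊓ F) = s at *
  generalize Nat.card ↥(sqSubgroup H ⊓ sqSubgroup F) = i at *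
  generalize Nat.card (sqSubgroup H) = a at *
  generalize Nat.card (sqSubgroup (H ⊔ F)) = n at *
  generalize Nat.card ↥(sqSubgroup H ⊔ sqSubgroup F) = m at *
  generalize Nat.card (sqSubgroup F) = b at *
  generalize Nat.card (sqSubgroup (H ⊓ F)) = t at *
  rw [h7, h6] at h1
  refine Nat.le_of_mul_le_mul_right (c := a * n * s * i) ?_ (by positivity)
  calc r * (a * n * s * i) = r * a * s * i * n := by ring
    _ ≤ r * a * s * i * m := by gcongr
    _ = r * a * s * (m * i) := by ring
    _ = r * a * a * (s * b) := by rw [h2]; ring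
    _ ≤ r * a * a * (Nat.card F * i) :=
      Nat.mul_le_mul_left _ (h4.trans (Nat.mul_le_mul_left _ h5))
    _ = (r * a * Nat.card F) * a * i := by ring
    _ = r' * (a * n * s * i) := by rw [← h1]; ring

end dMaximal

/-- A finite `2`-group is `d`-maximal iff it is `d`-maximal for normal subgroups. -/
theorem stmt15 {G : Type*} [Group G] [Finite G] (hG : IsPGroup 2 G) :
    (∀ H : Subgroup G, H ≠ ⊤ → Group.rank H < Group.rank G) ↔
      (∀ N : Subgroup G, N.Normal → N ≠ ⊤ → Group.rank N < Group.rank G) := by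
  refine ⟨fun h N _ hN => h N hN, fun h H hH => ?_⟩
  have hle := hG.rank_le_rank_sup (hG.commutator_sqSubgroup_top_le_of_rank_lt h) H
  refine hle.trans_lt (h _ (normal_of_sqSubgroup_top_le le_sup_right) fun e => hH ?_)
  exact frattini_nongenerating (top_le_iff.1
    (e.ge.trans (sup_le_sup_left hG.sqSubgroup_top_le_frattini _)))
end

section
/- Let G be a finite 2-group and A a finite 2-group acting on G. If the quotient G/G^4 is d-maximal for the induced A-subgroups, then G is d-maximal for A-subgroups. -/
/-- The subgroup of `G` generated by all `k`-th powers. -/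
def Gpow (G : Type*) [Group G] (k : ℕ) : Subgroup G :=
  Subgroup.closure ((fun x : G => x ^ k) '' Set.univ)

instance Gpow_normal (G : Type*) [Group G] (k : ℕ) : (Gpow G k).Normal := by
  constructor
  intro x hx g
  have h : (Gpow G k).map (MulAut.conj g).toMonoidHom ≤ Gpow G k := by
    rw [Gpow, MonoidHom.map_closure]
    apply Subgroup.closure_mono
    rintro _ ⟨_, ⟨z, -, rfl⟩, rfl⟩
    refine ⟨g * z * g⁻¹, Set.mem_univ _, ?_⟩
    simp [conj_pow]
  exact h ⟨x, hx, rfl⟩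

/-- The subgroup generated by the squares of the elements of `H`. -/
def Subgroup.sq {G : Type*} [Group G] (H : Subgroup G) : Subgroup G :=
  Subgroup.closure ((fun x : G => x ^ 2) '' H)

open scoped commutatorElement

namespace Subgroup

variable {G : Type*} [Group G]

theorem sq_mem_sq {H : Subgroup G} {x : G} (hx : x ∈ H) : x ^ 2 ∈ H.sq :=
  subset_closure ⟨x, hx, rfl⟩

theorem sq_le_iff {H K : Subgroup G} : H.sq ≤ K ↔ ∀ x ∈ H, x ^ 2 ∈ K := by
  rw [sq, closure_le]
  exact ⟨fun h x hx => h ⟨x, hx, rfl⟩, by rintro h _ ⟨x, hx, rfl⟩; exact h x hx⟩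

theorem sq_le (H : Subgroup G) : H.sq ≤ H :=
  sq_le_iff.2 fun _ hx => H.pow_mem hx 2

theorem sq_mono {H K : Subgroup G} (h : H ≤ K) : H.sq ≤ K.sq :=
  sq_le_iff.2 fun _ hx => sq_mem_sq (h hx)

theorem map_sq {G' : Type*} [Group G'] (f : G →* G') (H : Subgroup G) :
    H.sq.map f = (H.map f).sq := by
  apply le_antisymm
  · rw [map_le_iff_le_comap, sq_le_iff]
    intro x hx
    rw [mem_comap, map_pow]
    exact sq_mem_sq (mem_map_of_mem f hx)
  · rw [sq_le_iff]
    rintro _ ⟨x, hx, rfl⟩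
    rw [← map_pow]
    exact mem_map_of_mem f (sq_mem_sq hx)

instance sq_normal (H : Subgroup G) [hH : H.Normal] : H.sq.Normal := by
  refine normal_iff_map_conj_eq.2 fun g => ?_
  rw [map_sq, normal_iff_map_conj_eq.1 hH g]

theorem commutatorElement_mem_sq {H : Subgroup G} {x y : G} (hx : x ∈ H) (hy : y ∈ H) :
    ⁅x, y⁆ ∈ H.sq := by
  have h : ⁅x, y⁆ = (x * y) ^ 2 * (y⁻¹ * x⁻¹ * y) ^ 2 * y⁻¹ ^ 2 := by
    simp only [commutatorElement_def, pow_two]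
    group
  rw [h]
  exact mul_mem (mul_mem (sq_mem_sq (mul_mem hx hy))
    (sq_mem_sq (mul_mem (mul_mem (inv_mem hy) (inv_mem hx)) hy))) (sq_mem_sq (inv_mem hy))

theorem exists_le_index_eq_two [Finite G] (hG : IsPGroup 2 G) {H : Subgroup G} (hH : H ≠ ⊤) :
    ∃ K : Subgroup G, H ≤ K ∧ K.index = 2 := by
  obtain ⟨n, hn⟩ := IsPGroup.iff_card.1 hG
  obtain ⟨m, hm⟩ := IsPGroup.iff_card.1 (hG.to_subgroup H)
  have hmn : m < n := by
    have := H.card_le_card_group.lt_of_ne (fun h => hH (H.eq_top_of_card_eq h))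
    rw [hn, hm] at this
    exact (Nat.pow_lt_pow_iff_right (by norm_num)).1 this
  obtain ⟨k, rfl⟩ : ∃ k, n = k + 1 := ⟨n - 1, by omega⟩
  have : Fact (Nat.Prime 2) := ⟨Nat.prime_two⟩
  obtain ⟨K, hK, hHK⟩ := Sylow.exists_subgroup_card_pow_prime_le 2
    (by rw [hn]; exact pow_dvd_pow 2 (Nat.le_succ k)) H hm (by omega : m ≤ k)
  refine ⟨K, hHK, ?_⟩
  have h := K.card_mul_index
  rw [hn, hK, pow_succ] at h
  exact Nat.eq_of_mul_eq_mul_left (by positivity) h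

theorem sq_top_le_frattini [Finite G] (hG : IsPGroup 2 G) : (⊤ : Subgroup G).sq ≤ frattini G := by
  rw [frattini, Order.radical]
  refine le_iInf₂ fun K hK => sq_le_iff.2 fun x _ => ?_
  obtain ⟨L, hKL, hL⟩ := exists_le_index_eq_two hG hK.1
  rcases hK.le_iff.1 hKL with rfl | rfl
  · simp at hL
  · exact sq_mem_of_index_two hL x

end Subgroup

theorem Group.two_pow_rank_le_card (G : Type*) [Group G] [Finite G] :
    2 ^ Group.rank G ≤ Nat.card G := by
  classical
  have := Fintype.ofFinite G
  obtain ⟨S, hS, hmax⟩ := Finset.exists_max_image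
    (Finset.univ.filter fun S : Finset G => 2 ^ S.card ≤ Nat.card (Subgroup.closure (S : Set G)))
    (fun S => Nat.card (Subgroup.closure (S : Set G))) ⟨∅, by simp⟩
  simp only [Finset.mem_filter, Finset.mem_univ, true_and] at hS hmax
  by_cases h : Subgroup.closure (S : Set G) = ⊤
  · refine (Nat.pow_le_pow_right (by norm_num) (Group.rank_le h)).trans (hS.trans ?_)
    exact Subgroup.card_le_card_group _
  · obtain ⟨x, hx⟩ : ∃ x, x ∉ Subgroup.closure (S : Set G) := by
      by_contra! hc
      exact h ((Subgroup.eq_top_iff' _).2 hc)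
    have hlt : Subgroup.closure (S : Set G) < Subgroup.closure ((insert x S : Finset G) : Set G) := by
      refine lt_of_le_of_ne (Subgroup.closure_mono (by simp)) fun he => hx ?_
      rw [he]
      exact Subgroup.subset_closure (by simp)
    have hne : (Subgroup.closure (S : Set G)).relIndex
        (Subgroup.closure ((insert x S : Finset G) : Set G)) ≠ 1 := fun he =>
      hlt.not_ge (Subgroup.relIndex_eq_one.1 he)
    have hmul := Subgroup.relIndex_mul_relIndex ⊥ _ _ bot_le hlt.le
    simp only [Subgroup.relIndex_bot_left] at hmul
    have hpos : 0 < Nat.card (Subgroup.closure ((insert x S : Finset G) : Set G)) := Nat.card_pos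
    have h0 : (Subgroup.closure (S : Set G)).relIndex
        (Subgroup.closure ((insert x S : Finset G) : Set G)) ≠ 0 := fun he => by
      rw [he, mul_zero] at hmul
      omega
    have h2 : Nat.card (Subgroup.closure (S : Set G)) * 2 ≤
        Nat.card (Subgroup.closure ((insert x S : Finset G) : Set G)) := by
      rw [← hmul]
      exact Nat.mul_le_mul_left _ (by omega)
    have hle := hmax (insert x S) ((Nat.pow_le_pow_right (by norm_num)
      (Finset.card_insert_le x S)).trans (by rw [pow_succ]; omega))
    have : 0 < Nat.card (Subgroup.closure (S : Set G)) := Nat.card_pos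
    omega

/-- The Burnside basis theorem for `2`-groups. -/
theorem IsPGroup.two_pow_rank_eq_index {G : Type*} [Group G] [Finite G] (hG : IsPGroup 2 G) :
    2 ^ Group.rank G = (⊤ : Subgroup G).sq.index := by
  classical
  have hV : ∀ v : G ⧸ (⊤ : Subgroup G).sq, v ^ 2 = 1 := by
    intro v
    obtain ⟨g, rfl⟩ := QuotientGroup.mk'_surjective _ v
    rw [← map_pow]
    exact (QuotientGroup.eq_one_iff _).2 (Subgroup.sq_mem_sq (Subgroup.mem_top g))
  have hrank : Group.rank G = Group.rank (G ⧸ (⊤ : Subgroup G).sq) := by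
    refine le_antisymm ?_ (Group.rank_le_of_surjective _ (QuotientGroup.mk'_surjective _))
    obtain ⟨S, hS, hgen⟩ := Group.rank_spec (G ⧸ (⊤ : Subgroup G).sq)
    rw [← hS, ← Finset.card_image_of_injective S (Quotient.out_injective)]
    refine Group.rank_le (frattini_nongenerating ?_)
    rw [eq_top_iff]
    refine le_trans ?_ (sup_le_sup_left (Subgroup.sq_top_le_frattini hG) _)
    have h1 : (Subgroup.closure ((S.image Quotient.out : Finset G) : Set G)).map
        (QuotientGroup.mk' (⊤ : Subgroup G).sq) = ⊤ := by
      rw [MonoidHom.map_closure, ← hgen, Finset.coe_image, Set.image_image]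
      congr 1
      simp
    have h2 := congrArg (Subgroup.comap (QuotientGroup.mk' (⊤ : Subgroup G).sq)) h1
    rw [Subgroup.comap_map_eq, QuotientGroup.ker_mk', Subgroup.comap_top] at h2
    exact h2.ge
  have hcomm : ∀ a b : G ⧸ (⊤ : Subgroup G).sq, a * b = b * a :=
    fun a b => by
      have h := hV (a * b)
      have ha := hV a
      have hb := hV b
      rw [sq, mul_eq_one_iff_eq_inv] at h ha hb
      rw [h, mul_inv_rev, ← ha, ← hb]
  let : CommGroup (G ⧸ (⊤ : Subgroup G).sq) := { mul_comm := hcomm }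
  rw [hrank]
  refine le_antisymm (Group.two_pow_rank_le_card _) ?_
  exact Nat.le_of_dvd (by positivity) (card_dvd_exponent_pow_rank' _ hV)

theorem Subgroup.two_pow_rank {G : Type*} [Group G] [Finite G] (hG : IsPGroup 2 G)
    (H : Subgroup G) : 2 ^ Group.rank H = H.sq.relIndex H := by
  rw [(hG.to_subgroup H).two_pow_rank_eq_index, relIndex]
  congr 1
  have h : (⊤ : Subgroup H).sq.map H.subtype = H.sq := by
    rw [map_sq, ← MonoidHom.range_eq_map, range_subtype]
  rw [subgroupOf, ← h, comap_map_eq_self_of_injective H.subtype_injective]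

namespace Subgroup

variable {G : Type*} [Group G]

/-- If `U ≤ T[U, G]` in a nilpotent group, with `T` normal, then `U ≤ T`. -/
theorem le_of_le_sup_commutator [Group.IsNilpotent G] {U T : Subgroup G} [T.Normal]
    (h : U ≤ T ⊔ ⁅U, (⊤ : Subgroup G)⁆) : U ≤ T := by
  have key : ∀ n, U ≤ T ⊔ (⊤ : Subgroup G).lowerCentralSeries n := by
    intro n
    induction n with
    | zero => simp
    | succ n ih =>
      refine h.trans (sup_le le_sup_left ?_)
      rw [commutator_le]
      intro u hu g hg
      obtain ⟨t, ht, l, hl, rfl⟩ := mem_sup_of_normal_left.1 (ih hu)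
      have e : ⁅t * l, g⁆ = t * ⁅l, g⁆ * t⁻¹ * ⁅t, g⁆ := by
        simp only [commutatorElement_def]
        group
      have ht' := mem_sup_left (T := (⊤ : Subgroup G).lowerCentralSeries (n + 1)) ht
      rw [e]
      refine mul_mem (mul_mem (mul_mem ht' (mem_sup_right ?_)) (inv_mem ht')) (mem_sup_left ?_)
      · rw [lowerCentralSeries_succ]
        exact commutator_mem_commutator hl hg
      · exact commutator_le_left T ⊤ (commutator_mem_commutator ht hg)
  obtain ⟨n, hn⟩ := nilpotent_iff_lowerCentralSeries.1 (inferInstance : Group.IsNilpotent G)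
  simpa [hn] using key n

theorem commute_sq_of_commutatorElement {y g : G} (hc : ⁅y, g⁆ ∈ center G)
    (h2 : ⁅y, g⁆ ^ 2 = 1) : Commute y (g ^ 2) := by
  have e : y * g * y⁻¹ = ⁅y, g⁆ * g := by
    simp only [commutatorElement_def]
    group
  have hcg : Commute ⁅y, g⁆ g := (mem_center_iff.1 hc g).symm
  have : y * g ^ 2 * y⁻¹ = g ^ 2 := by
    rw [← conj_pow, e, hcg.mul_pow, h2, one_mul]
  rw [commute_iff_eq]
  exact mul_inv_eq_iff_eq_mul.1 this

theorem commute_of_mem_sq {y n : G} {H : Subgroup G} (h : ∀ g ∈ H, Commute y (g ^ 2))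
    (hn : n ∈ H.sq) : Commute y n := by
  have : H.sq ≤ centralizer {y} := sq_le_iff.2 fun g hg => by
    rw [mem_centralizer_singleton_iff]
    exact (h g hg).symm
  exact (mem_centralizer_singleton_iff.1 (this hn)).symm

theorem sq_le_center {N : Subgroup G} [N.Normal] (hle : N ≤ (⊤ : Subgroup G).sq)
    (hN : ∀ n ∈ N, ∀ g, ⁅n, g⁆ ∈ N.sq) (h2 : ∀ y ∈ N.sq, y ^ 2 = 1)
    (hc : ∀ y ∈ N.sq, ∀ g, ⁅y, g⁆ ∈ center G) : N.sq ≤ center G := by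
  refine sq_le_iff.2 fun n hn => mem_center_iff.2 fun g => ?_
  have hcomm : Commute ⁅n, g⁆ n := commute_of_mem_sq (fun h _ =>
    commute_sq_of_commutatorElement (hc _ (hN n hn g) h)
      (h2 _ (hN _ (N.sq_le (hN n hn g)) h))) (hle hn)
  have e : g * n * g⁻¹ = ⁅n, g⁆⁻¹ * n := by
    simp only [commutatorElement_def]
    group
  have : g * n ^ 2 * g⁻¹ = n ^ 2 := by
    rw [← conj_pow, e, hcomm.inv_left.mul_pow, inv_pow, h2 _ (hN n hn g), inv_one, one_mul]
  exact mul_inv_eq_iff_eq_mul.1 this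

theorem mk'_mem_center_iff {X : Subgroup G} [X.Normal] {y : G} :
    QuotientGroup.mk' X y ∈ center (G ⧸ X) ↔ ∀ g, ⁅y, g⁆ ∈ X := by
  rw [mem_center_iff, (QuotientGroup.mk'_surjective X).forall]
  refine forall_congr' fun g => ?_
  rw [← QuotientGroup.eq_one_iff, ← QuotientGroup.mk'_apply, map_commutatorElement,
    commutatorElement_eq_one_iff_mul_comm, eq_comm]

theorem commutator_sq_top_le [Group.IsNilpotent G] {N : Subgroup G} [N.Normal]
    (hle : N ≤ (⊤ : Subgroup G).sq) (h : ⁅N, (⊤ : Subgroup G)⁆ ≤ N.sq) :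
    ⁅N.sq, (⊤ : Subgroup G)⁆ ≤ N.sq.sq := by
  apply le_of_le_sup_commutator
  set X : Subgroup G := N.sq.sq ⊔ ⁅⁅N.sq, (⊤ : Subgroup G)⁆, (⊤ : Subgroup G)⁆ with hX
  have hsurj := QuotientGroup.mk'_surjective X
  have : (N.map (QuotientGroup.mk' X)).Normal := Normal.map inferInstance _ hsurj
  have key : (N.map (QuotientGroup.mk' X)).sq ≤ center (G ⧸ X) := by
    apply sq_le_center
    · rw [← map_top_of_surjective _ hsurj, ← map_sq]
      exact map_mono hle
    · rintro _ ⟨n, hn, rfl⟩ g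
      obtain ⟨g, rfl⟩ := hsurj g
      rw [← map_commutatorElement, ← map_sq]
      exact mem_map_of_mem _ (h (commutator_mem_commutator hn (mem_top g)))
    · rw [← map_sq]
      rintro _ ⟨y, hy, rfl⟩
      rw [← map_pow]
      exact (QuotientGroup.eq_one_iff _).2 (mem_sup_left (sq_mem_sq hy))
    · rw [← map_sq]
      rintro _ ⟨y, hy, rfl⟩ g
      obtain ⟨g, rfl⟩ := hsurj g
      rw [← map_commutatorElement, mk'_mem_center_iff]
      exact fun k => mem_sup_right (commutator_mem_commutator
        (commutator_mem_commutator hy (mem_top g)) (mem_top k))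
  rw [← map_sq] at key
  refine commutator_le.2 fun y hy g _ => (QuotientGroup.eq_one_iff _).1 ?_
  change QuotientGroup.mk' X ⁅y, g⁆ = 1
  rw [map_commutatorElement, commutatorElement_eq_one_iff_mul_comm]
  exact (mem_center_iff.1 (key (mem_map_of_mem _ hy)) _).symm

theorem commutator_sq_top_le_sq_sq [Group.IsNilpotent G] {N : Subgroup G} [N.Normal]
    (hle : N ≤ (⊤ : Subgroup G).sq) (h : ⁅N, (⊤ : Subgroup G)⁆ ≤ N.sq) :
    ⁅N, (⊤ : Subgroup G).sq⁆ ≤ N.sq.sq := by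
  have hA := commutator_sq_top_le hle h
  refine commutator_le.2 fun n hn m hm => ?_
  rw [← QuotientGroup.eq_one_iff, ← QuotientGroup.mk'_apply, map_commutatorElement,
    commutatorElement_eq_one_iff_commute]
  have hm' := mem_map_of_mem (QuotientGroup.mk' N.sq.sq) hm
  rw [map_sq, map_top_of_surjective _ (QuotientGroup.mk'_surjective _)] at hm'
  refine commute_of_mem_sq (fun g _ => ?_) hm'
  obtain ⟨g, rfl⟩ := QuotientGroup.mk'_surjective _ g
  have hc := h (commutator_mem_commutator hn (mem_top g))
  apply commute_sq_of_commutatorElement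
  · rw [← map_commutatorElement, mk'_mem_center_iff]
    exact fun k => hA (commutator_mem_commutator hc (mem_top k))
  · rw [← map_commutatorElement, ← map_pow]
    exact (QuotientGroup.eq_one_iff _).2 (sq_mem_sq hc)

theorem relIndex_sq_le_relIndex_sq_sup [Finite G] {H N T : Subgroup G} [N.Normal] [T.Normal]
    (hTN : T ≤ N) (hNT : N.sq ≤ T) (hHN : ⁅H, N⁆ ≤ T) (hH : H.sq ≤ N)
    (hK : (H ⊓ N).sq.relIndex (H ⊓ N) ≤ T.relIndex N) :
    H.sq.relIndex H ≤ (H ⊔ N).sq.relIndex (H ⊔ N) := by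
  have hL : (H ⊔ N).sq ≤ H.sq ⊔ T := by
    refine sq_le_iff.2 fun x hx => ?_
    obtain ⟨h, hh, n, hn, rfl⟩ := mem_sup_of_normal_right.1 hx
    have e : (h * n) ^ 2 = h ^ 2 * (⁅h⁻¹, n⁆ * n ^ 2) := by
      simp only [commutatorElement_def, pow_two]
      group
    rw [e]
    exact mul_mem (mem_sup_left (sq_mem_sq hh)) (mem_sup_right (mul_mem
      (hHN (commutator_mem_commutator (inv_mem hh) hn)) (hNT (sq_mem_sq hn))))
  have hHK : H.sq ≤ H ⊓ N := le_inf H.sq_le hH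
  have h1 := relIndex_mul_relIndex H.sq (H ⊓ N) H hHK inf_le_left
  have h2 := relIndex_mul_relIndex (H ⊔ N).sq N (H ⊔ N) (hL.trans (sup_le hH hTN)) le_sup_right
  have h3 := relIndex_mul_relIndex (H ⊓ N).sq H.sq (H ⊓ N) (sq_mono inf_le_left) hHK
  have h4 := relIndex_mul_relIndex T (H.sq ⊔ T) N le_sup_right (sup_le hH hTN)
  have h5 : T.relIndex (H.sq ⊔ T) ≤ (H ⊓ N).sq.relIndex H.sq := by
    rw [relIndex_sup_right]
    exact relIndex_le_of_le_left ((sq_mono inf_le_right).trans hNT) index_ne_zero_of_finite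
  have h6 : H.sq.relIndex (H ⊓ N) ≤ (H.sq ⊔ T).relIndex N := by
    have hpos : 0 < T.relIndex (H.sq ⊔ T) := Nat.pos_of_ne_zero index_ne_zero_of_finite
    refine Nat.le_of_mul_le_mul_left ?_ hpos
    rw [h4]
    refine le_trans ?_ hK
    rw [← h3]
    exact Nat.mul_le_mul_right _ h5
  have h7 := relIndex_le_of_le_left hL (L := N) index_ne_zero_of_finite
  rw [← h1, ← h2, relIndex_sup_right, inf_comm, inf_relIndex_right, inf_comm]
  exact Nat.mul_le_mul_right _ (h6.trans h7)

theorem relIndex_sq_sq_le [Finite G] {L N T : Subgroup G} [T.Normal] (hLN : L ≤ N)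
    (hT : T ≤ L.sq) (hN : ⁅N, N⁆ ≤ T) : L.sq.relIndex N.sq ≤ L.relIndex N := by
  let f : N →* G ⧸ T := MonoidHom.mk' (fun n => QuotientGroup.mk' T n ^ 2) fun a b => by
    have hab : Commute (QuotientGroup.mk' T a) (QuotientGroup.mk' T b) := by
      rw [← commutatorElement_eq_one_iff_commute, ← map_commutatorElement]
      exact (QuotientGroup.eq_one_iff _).2 (hN (commutator_mem_commutator a.2 b.2))
    rw [coe_mul, map_mul, hab.mul_pow]
  have hf : ∀ J ≤ N, (J.subgroupOf N).map f = J.sq.map (QuotientGroup.mk' T) := by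
    intro J hJ
    apply le_antisymm
    · rintro _ ⟨x, hx, rfl⟩
      exact ⟨x ^ 2, sq_mem_sq hx, map_pow _ _ _⟩
    · rw [map_le_iff_le_comap, sq_le_iff]
      exact fun x hx => ⟨⟨x, hJ hx⟩, hx, (map_pow _ _ _).symm⟩
  have h1 := relIndex_map_map (QuotientGroup.mk' T) L.sq N.sq
  have h2 := relIndex_map_map f (L.subgroupOf N) (N.subgroupOf N)
  rw [hf L hLN, hf N le_rfl, h1, QuotientGroup.ker_mk', sup_eq_left.2 hT,
    sup_eq_left.2 (hT.trans (sq_mono hLN)), subgroupOf_self, top_sup_eq, relIndex_top_right] at h2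
  rw [h2]
  exact index_antitone le_sup_left

theorem sq_lt [Finite G] (hG : IsPGroup 2 G) {N : Subgroup G} (hN : N ≠ ⊥) : N.sq < N := by
  refine lt_of_le_of_ne N.sq_le fun h => hN ?_
  have := two_pow_rank hG N
  rw [relIndex_eq_one.2 h.ge] at this
  have h0 : Group.rank N = 0 := by simpa using this
  rw [Group.rank_eq_zero_iff] at h0
  exact eq_bot_of_subsingleton N

/-- A normal subgroup `N ≤ G²` with `[N, G] ≤ N²` is powerful, so that its subgroups need no more
generators than `N` does. -/
theorem relIndex_sq_le_of_le [Finite G] (hG : IsPGroup 2 G) {K N : Subgroup G} [N.Normal]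
    (hle : N ≤ (⊤ : Subgroup G).sq) (h : ⁅N, (⊤ : Subgroup G)⁆ ≤ N.sq) (hKN : K ≤ N) :
    K.sq.relIndex K ≤ N.sq.relIndex N := by
  have : Fact (Nat.Prime 2) := ⟨Nat.prime_two⟩
  have : Group.IsNilpotent G := hG.isNilpotent
  induction hn : Nat.card N using Nat.strong_induction_on generalizing K N with
  | _ n ih =>
    by_cases hN : N = ⊥
    · obtain rfl : K = N := le_antisymm hKN (hN ▸ bot_le)
      rfl
    have hlt := sq_lt hG hN
    have hsq := commutator_sq_top_le hle h
    have hcard : Nat.card N.sq < n := hn ▸ Set.Finite.card_lt_card (Set.toFinite _) hlt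
    have hKs := ih _ hcard (K := K ⊓ N.sq) (N.sq_le.trans hle) hsq inf_le_right rfl
    have h1 := relIndex_sq_le_relIndex_sq_sup (H := K) N.sq.sq_le le_rfl
      ((commutator_mono le_top le_rfl).trans ((commutator_comm_le _ _).trans hsq))
      (sq_mono hKN) hKs
    refine h1.trans ?_
    have hLN : K ⊔ N.sq ≤ N := sup_le hKN N.sq_le
    rw [← relIndex_mul_relIndex N.sq _ N le_sup_right hLN,
      ← relIndex_mul_relIndex _ N.sq (K ⊔ N.sq) (sq_mono hLN) le_sup_right, mul_comm]
    exact Nat.mul_le_mul_left _ (relIndex_sq_sq_le hLN (sq_mono le_sup_right)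
      ((commutator_mono le_rfl hle).trans (commutator_sq_top_le_sq_sq hle h)))

end Subgroup

theorem card_monoidHom_units_int_le (V : Type*) [Group V] [Finite V] :
    Nat.card (V →* ℤˣ) ≤ Nat.card V := by
  classical
  have := Fintype.ofFinite V
  have := Fintype.ofFinite (V →* ℤˣ)
  have h := (linearIndependent_monoidHom V ℤ).comp (fun f : V →* ℤˣ => (Units.coeHom ℤ).comp f)
    fun f g hfg => MonoidHom.ext fun v => Units.ext (DFunLike.congr_fun hfg v)
  simpa [Nat.card_eq_fintype_card] using h.fintype_card_le_finrank

namespace Subgroup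

variable {G : Type*} [Group G]

theorem index_centralizer_le_relIndex_center [Finite G] {N W : Subgroup G}
    (hW : W ≤ center G) (hcard : Nat.card W = 2) (hN : ∀ n ∈ N, ∀ g, ⁅n, g⁆ ∈ W) :
    (centralizer (N : Set G)).index ≤ (center G).relIndex N := by
  have : Fact (Nat.Prime 2) := ⟨Nat.prime_two⟩
  let χ : W ≃* ℤˣ := mulEquivOfPrimeCardEq (p := 2) hcard (by simp)
  have hχ : ∀ {a b c : G} (ha : a ∈ W) (hb : b ∈ W) (hc : c ∈ W), a = b * c →
      χ ⟨a, ha⟩ = χ ⟨b, hb⟩ * χ ⟨c, hc⟩ := by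
    rintro a b c ha hb hc rfl
    rw [← map_mul]
    rfl
  have conj : ∀ {w : G} (g : G), w ∈ W → g * w * g⁻¹ = w := fun g hw =>
    mul_inv_eq_iff_eq_mul.2 (mem_center_iff.1 (hW hw) g)
  let β : G →* (N →* ℤˣ) := MonoidHom.mk'
    (fun g => MonoidHom.mk' (fun n => χ ⟨⁅(n : G), g⁆, hN n n.2 g⟩) fun a b =>
      hχ _ _ _ (by
        rw [mem_center_iff.1 (hW (hN b b.2 g)), ← conj (a : G) (hN b b.2 g), coe_mul]
        simp only [commutatorElement_def]
        group))
    fun g h => MonoidHom.ext fun n => hχ _ _ _ (by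
        rw [← conj g (hN n n.2 h)]
        simp only [commutatorElement_def]
        group)
  have hβ : ∀ g (n : N), β g n = 1 ↔ Commute (n : G) g := by
    intro g n
    change χ ⟨⁅(n : G), g⁆, hN n n.2 g⟩ = 1 ↔ _
    rw [map_eq_one_iff χ χ.injective, ← commutatorElement_eq_one_iff_commute, Subtype.ext_iff]
    rfl
  have hker : β.ker = centralizer (N : Set G) := by
    ext g
    rw [MonoidHom.mem_ker, mem_centralizer_iff, MonoidHom.ext_iff]
    exact ⟨fun h n hn => (hβ g ⟨n, hn⟩).1 (h ⟨n, hn⟩), fun h n => (hβ g n).2 (h n n.2)⟩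
  have hD : ∀ f ∈ β.range, (center G).subgroupOf N ≤ f.ker := by
    rintro _ ⟨g, rfl⟩ n hn
    exact (hβ g n).2 (mem_center_iff.1 hn g).symm
  rw [← hker, index_ker]
  refine le_trans ?_ (card_monoidHom_units_int_le (N ⧸ (center G).subgroupOf N))
  refine Nat.card_le_card_of_injective
    (fun f : β.range => QuotientGroup.lift _ f.1 (hD f.1 f.2)) fun f f' hff => ?_
  refine Subtype.ext (MonoidHom.ext fun n => ?_)
  exact DFunLike.congr_fun hff (QuotientGroup.mk n)

theorem sq_mem_center_of_mem_centralizer (h4 : ∀ x : G, x ^ 4 = 1)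
    (hc : ∀ n ∈ (⊤ : Subgroup G).sq, ∀ g, ⁅n, g⁆ ∈ center G)
    (h2 : ∀ n ∈ (⊤ : Subgroup G).sq, ∀ g : G, ⁅n, g⁆ ^ 2 = 1) {x : G}
    (hx : x ∈ centralizer ((⊤ : Subgroup G).sq : Set G)) : x ^ 2 ∈ center G := by
  refine mem_center_iff.2 fun g => ?_
  have hv : ⁅x⁻¹, g⁆ ∈ (⊤ : Subgroup G).sq := commutatorElement_mem_sq (mem_top _) (mem_top _)
  have hxv : Commute x ⁅x⁻¹, g⁆ := (mem_centralizer_iff.1 hx _ hv).symm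
  have hxg : Commute x (g ^ 2) := (mem_centralizer_iff.1 hx _ (sq_mem_sq (mem_top g))).symm
  have hvg : Commute ⁅x⁻¹, g⁆ (g ^ 2) := commute_sq_of_commutatorElement (hc _ hv g) (h2 _ hv g)
  have e : g * x * g⁻¹ = x * ⁅x⁻¹, g⁆ := by
    simp only [commutatorElement_def]
    group
  have e2 : (x * g) ^ 2 = x ^ 2 * (⁅x⁻¹, g⁆ * g ^ 2) := by
    simp only [commutatorElement_def, pow_two]
    group
  have hv2 : ⁅x⁻¹, g⁆ ^ 2 = 1 := by
    have h := h4 (x * g)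
    rw [pow_mul (x * g) 2 2, e2, ((hxv.mul_right hxg).pow_left 2).mul_pow, hvg.mul_pow,
      ← pow_mul, ← pow_mul, h4, h4, one_mul, mul_one] at h
    exact h
  have : g * x ^ 2 * g⁻¹ = x ^ 2 := by
    rw [← conj_pow, e, hxv.mul_pow, hv2, mul_one]
  exact mul_inv_eq_iff_eq_mul.1 this

end Subgroup

section Action

open Subgroup

variable {A G : Type*} [Group A] [Group G] [MulDistribMulAction A G]

theorem AInv.sq {H : Subgroup G} (hH : AInv A H) : AInv A H.sq := by
  intro a g hg
  have h : H.sq ≤ H.sq.comap (MulDistribMulAction.toMonoidHom G a) :=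
    sq_le_iff.2 fun x hx => by
      change a • x ^ 2 ∈ H.sq
      rw [smul_pow']
      exact sq_mem_sq (hH a x hx)
  exact h hg

theorem AInv.sup {H K : Subgroup G} (hH : AInv A H) (hK : AInv A K) : AInv A (H ⊔ K) := by
  intro a g hg
  have h : H ⊔ K ≤ (H ⊔ K).comap (MulDistribMulAction.toMonoidHom G a) :=
    sup_le (fun x hx => mem_sup_left (hH a x hx)) (fun x hx => mem_sup_right (hK a x hx))
  exact h hg

theorem smul_commutatorElement (a : A) (x y : G) : a • ⁅x, y⁆ = ⁅a • x, a • y⁆ :=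
  map_commutatorElement (MulDistribMulAction.toMonoidHom G a) x y

theorem AInv.commutator {H K : Subgroup G} (hH : AInv A H) (hK : AInv A K) : AInv A ⁅H, K⁆ := by
  intro a g hg
  have h : ⁅H, K⁆ ≤ ⁅H, K⁆.comap (MulDistribMulAction.toMonoidHom G a) :=
    commutator_le.2 fun x hx y hy => by
      change a • ⁅x, y⁆ ∈ ⁅H, K⁆
      rw [smul_commutatorElement]
      exact commutator_mem_commutator (hH a x hx) (hK a y hy)
  exact h hg

theorem AInv.map_inl_normal {H : Subgroup G} [H.Normal] (hH : AInv A H) :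
    (H.map (SemidirectProduct.inl (φ := MulDistribMulAction.toMulAut A G))).Normal := by
  constructor
  rintro _ ⟨h, hh, rfl⟩ p
  refine ⟨p.left * (p.right • h) * p.left⁻¹, Normal.conj_mem inferInstance _ (hH _ _ hh) _, ?_⟩
  ext <;> simp [mul_assoc]

/-- Between two distinct invariant normal subgroups there is an invariant one of index `2` in
the larger, modulo which the larger is central. -/
theorem AInv.exists_relIndex_eq_two [Finite A] [Finite G] (hA : IsPGroup 2 A) (hG : IsPGroup 2 G)
    {T W : Subgroup G} [T.Normal] [W.Normal] (hT : AInv A T) (hW : AInv A W) (hTW : T < W) :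
    ∃ Y : Subgroup G, T ≤ Y ∧ Y ≤ W ∧ Y.relIndex W = 2 ∧ AInv A Y ∧
      ⁅W, (⊤ : Subgroup G)⁆ ≤ Y := by
  have : Fact (Nat.Prime 2) := ⟨Nat.prime_two⟩
  let P := G ⋊[MulDistribMulAction.toMulAut A G] A
  have hfin : Finite P := Finite.of_equiv _ SemidirectProduct.equivProd.symm
  have hP : IsPGroup 2 P := by
    obtain ⟨m, hm⟩ := IsPGroup.iff_card.1 hA
    obtain ⟨n, hn⟩ := IsPGroup.iff_card.1 hG
    exact IsPGroup.iff_card.2 ⟨n + m, by rw [SemidirectProduct.card, hn, hm, pow_add]⟩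
  have : Group.IsNilpotent P := hP.isNilpotent
  let ι : G →* P := SemidirectProduct.inl
  have hι : Function.Injective ι := SemidirectProduct.inl_injective
  have hTn : (T.map ι).Normal := hT.map_inl_normal
  have hWn : (W.map ι).Normal := hW.map_inl_normal
  let X : Subgroup P := T.map ι ⊔ ⁅W.map ι, (⊤ : Subgroup P)⁆
  have hXW : X ≤ W.map ι := sup_le (map_mono hTW.le) (commutator_le_left _ _)
  have hX : (X.comap ι).subgroupOf W ≠ ⊤ := by
    intro h
    rw [subgroupOf_eq_top, ← map_le_iff_le_comap] at h
    exact hTW.not_ge ((map_le_map_iff_of_injective hι).1 (le_of_le_sup_commutator h))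
  obtain ⟨K, hXK, hK⟩ := exists_le_index_eq_two (hG.to_subgroup W) hX
  have hXY : X.comap ι ≤ K.map W.subtype := by
    intro x hx
    have hxW : x ∈ W := by
      obtain ⟨w, hw, hwx⟩ := hXW hx
      exact hι hwx ▸ hw
    exact ⟨⟨x, hxW⟩, hXK hx, rfl⟩
  have hcomm : ∀ w ∈ W, ∀ p : P, ∀ g : G, ι g = ⁅ι w, p⁆ → g ∈ K.map W.subtype :=
    fun w hw p g hg => hXY (mem_comap.2 (hg ▸ mem_sup_right
      (commutator_mem_commutator (mem_map_of_mem ι hw) (mem_top p))))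
  refine ⟨K.map W.subtype, ?_, map_subtype_le K, ?_, ?_, ?_⟩
  · exact fun t ht => hXY (mem_sup_left (mem_map_of_mem ι ht))
  · rw [relIndex, subgroupOf, comap_map_eq_self_of_injective W.subtype_injective, hK]
  · intro a y hy
    have h := hcomm y (map_subtype_le K hy) (SemidirectProduct.inr a) (y * (a • y)⁻¹) (by
      have e : ι (a • y) = SemidirectProduct.inr a * ι y * SemidirectProduct.inr a⁻¹ :=
        SemidirectProduct.inl_aut a y
      rw [commutatorElement_def, map_mul, map_inv, e, map_inv]
      group)
    have := mul_mem (inv_mem h) hy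
    simpa using this
  · exact commutator_le.2 fun w hw g _ => hcomm w hw (ι g) _ (map_commutatorElement ι w g)

theorem AInv.commutator_sq_top_le [Finite A] [Finite G] (hA : IsPGroup 2 A) (hG : IsPGroup 2 G)
    (hmax : ∀ L : Subgroup G, AInv A L → (⊤ : Subgroup G).sq ≤ L → L ≠ ⊤ →
      Group.rank L < Group.rank G) :
    ⁅(⊤ : Subgroup G).sq, (⊤ : Subgroup G)⁆ ≤ (⊤ : Subgroup G).sq.sq := by
  by_contra hlt
  have hTop : AInv A (⊤ : Subgroup G) := fun _ _ _ => mem_top _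
  set N : Subgroup G := (⊤ : Subgroup G).sq with hNdef
  have hN : AInv A N := hTop.sq
  obtain ⟨Y, hTY, hYW, hY2, hY, hWY⟩ := AInv.exists_relIndex_eq_two hA hG hN.sq
    (hN.sq.sup (hN.commutator hTop)) (lt_of_le_not_ge (le_sup_left (b := ⁅N, (⊤ : Subgroup G)⁆))
      fun h => hlt (le_sup_right.trans h))
  set W : Subgroup G := N.sq ⊔ ⁅N, (⊤ : Subgroup G)⁆
  have hYn : Y.Normal := commutator_top_right_le_iff.1 ((commutator_mono hYW le_rfl).trans hWY)
  let π := QuotientGroup.mk' Y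
  have hπ : Function.Surjective π := QuotientGroup.mk'_surjective Y
  have hπN : N.map π = (⊤ : Subgroup (G ⧸ Y)).sq := by
    rw [hNdef, map_sq, map_top_of_surjective π hπ]
  have hWc : W.map π ≤ center (G ⧸ Y) := by
    rintro _ ⟨w, hw, rfl⟩
    exact mk'_mem_center_iff.2 fun g => hWY (commutator_mem_commutator hw (mem_top g))
  have hWcard : Nat.card (W.map π) = 2 := by
    rw [← relIndex_ker, QuotientGroup.ker_mk', hY2]
  have hNW : ∀ n ∈ N.map π, ∀ g, ⁅n, g⁆ ∈ W.map π := by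
    rintro _ ⟨n, hn, rfl⟩ g
    obtain ⟨g, rfl⟩ := hπ g
    rw [← map_commutatorElement]
    exact mem_map_of_mem π (mem_sup_right (commutator_mem_commutator hn (mem_top g)))
  have hW2 : ∀ w ∈ W.map π, w ^ 2 = 1 := fun w hw => by
    have := pow_card_eq_one' (x := (⟨w, hw⟩ : W.map π))
    rw [hWcard] at this
    exact congrArg Subtype.val this
  have hN2 : ∀ n ∈ N.map π, ∀ g : G ⧸ Y, Commute n (g ^ 2) := fun n hn g =>
    commute_sq_of_commutatorElement (hWc (hNW n hn g)) (hW2 _ (hNW n hn g))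
  let C : Subgroup G := (centralizer (N.map π : Set (G ⧸ Y))).comap π
  let D : Subgroup G := (center (G ⧸ Y)).comap π ⊓ N
  have hCmem : ∀ g, g ∈ C ↔ ∀ n ∈ N, ⁅n, g⁆ ∈ Y := by
    intro g
    rw [mem_comap, mem_centralizer_iff]
    simp only [coe_map, Set.forall_mem_image, SetLike.mem_coe]
    refine forall₂_congr fun n _ => ?_
    rw [← QuotientGroup.eq_one_iff, ← QuotientGroup.mk'_apply, map_commutatorElement,
      commutatorElement_eq_one_iff_mul_comm]
  have hCinv : AInv A C := fun a g hg => (hCmem _).2 fun n hn => by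
    have := hY a _ ((hCmem g).1 hg (a⁻¹ • n) (hN a⁻¹ n hn))
    rwa [smul_commutatorElement, smul_inv_smul] at this
  have hNC : N ≤ C := fun m hm n hn => by
    have hm' := mem_map_of_mem π hm
    rw [hπN] at hm'
    exact (commute_of_mem_sq (fun g _ => hN2 n hn g) hm').eq
  have hCtop : C ≠ ⊤ := fun h => by
    have hWY' : W ≤ Y := sup_le hTY
      (commutator_le.2 fun n hn g _ => (hCmem g).1 (h ▸ mem_top g) n hn)
    rw [relIndex_eq_one.2 hWY'] at hY2
    omega
  have hCD : C.sq ≤ D := by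
    refine sq_le_iff.2 fun x hx => ⟨?_, sq_mem_sq (mem_top x)⟩
    change π (x ^ 2) ∈ center (G ⧸ Y)
    rw [map_pow]
    refine sq_mem_center_of_mem_centralizer (fun y => ?_) ?_ ?_ ?_
    · obtain ⟨y, rfl⟩ := hπ y
      rw [← map_pow, pow_mul y 2 2]
      exact (QuotientGroup.eq_one_iff _).2 (hTY (sq_mem_sq (sq_mem_sq (mem_top y))))
    · exact hπN ▸ fun n hn g => hWc (hNW n hn g)
    · exact hπN ▸ fun n hn g => hW2 _ (hNW n hn g)
    · exact hπN ▸ hx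
  have hindex : C.index ≤ D.relIndex N := by
    rw [inf_relIndex_right, relIndex_comap, index_comap_of_surjective _ hπ]
    exact index_centralizer_le_relIndex_center hWc hWcard hNW
  have hrank := hmax C hCinv hNC hCtop
  rw [← Nat.pow_lt_pow_iff_right (a := 2) (by norm_num), two_pow_rank hG,
    hG.two_pow_rank_eq_index] at hrank
  refine hrank.not_ge ?_
  rw [← hNdef, ← relIndex_mul_index hNC, mul_comm]
  refine le_trans (Nat.mul_le_mul_right _ hindex) ?_
  rw [relIndex_mul_relIndex D N C inf_le_right hNC]
  exact relIndex_le_of_le_left hCD index_ne_zero_of_finite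

end Action

theorem Subgroup.rank_map_mk' {G : Type*} [Group G] [Finite G] (hG : IsPGroup 2 G)
    {T L : Subgroup G} [T.Normal] (hT : T ≤ L.sq) :
    Group.rank (L.map (QuotientGroup.mk' T)) = Group.rank L := by
  apply Nat.pow_right_injective le_rfl
  change 2 ^ Group.rank (L.map (QuotientGroup.mk' T)) = 2 ^ Group.rank L
  rw [two_pow_rank (hG.to_quotient T), two_pow_rank hG, ← map_sq, relIndex_map_map,
    QuotientGroup.ker_mk', sup_eq_left.2 hT, sup_eq_left.2 (hT.trans L.sq_le)]

theorem Gpow_four_le {G : Type*} [Group G] : Gpow G 4 ≤ (⊤ : Subgroup G).sq.sq := by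
  rw [Gpow, Subgroup.closure_le]
  rintro _ ⟨x, -, rfl⟩
  change x ^ 4 ∈ (⊤ : Subgroup G).sq.sq
  rw [pow_mul x 2 2]
  exact Subgroup.sq_mem_sq (Subgroup.sq_mem_sq (Subgroup.mem_top x))

/-- If `G/G⁴` is `d`-maximal for the induced `A`-subgroups (invariance read off via
preimages in `G`), then `G` is `d`-maximal for `A`-subgroups. -/
theorem stmt16 {A G : Type*} [Group A] [Finite A] [Group G] [Finite G]
    [MulDistribMulAction A G] (hG : IsPGroup 2 G) (hA : IsPGroup 2 A)
    (hq : ∀ K : Subgroup (G ⧸ Gpow G 4),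
      AInv A (K.comap (QuotientGroup.mk' (Gpow G 4))) → K ≠ ⊤ →
        Group.rank K < Group.rank (G ⧸ Gpow G 4)) :
    DMax A G := by
  have hmax : ∀ L : Subgroup G, AInv A L → (⊤ : Subgroup G).sq ≤ L → L ≠ ⊤ →
      Group.rank L < Group.rank G := by
    intro L hL hNL hLtop
    have hTL : Gpow G 4 ≤ L.sq := Gpow_four_le.trans (Subgroup.sq_mono hNL)
    have hcomap : (L.map (QuotientGroup.mk' (Gpow G 4))).comap (QuotientGroup.mk' (Gpow G 4)) =
        L := by
      rw [Subgroup.comap_map_eq, QuotientGroup.ker_mk', sup_eq_left.2 (hTL.trans L.sq_le)]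
    have h := hq (L.map (QuotientGroup.mk' (Gpow G 4))) (hcomap.symm ▸ hL) fun h => hLtop (by
      rw [← hcomap, h, Subgroup.comap_top])
    have hGrank : Group.rank (G ⧸ Gpow G 4) = Group.rank G := by
      have := Subgroup.rank_map_mk' hG (L := ⊤) (hTL.trans (Subgroup.sq_mono le_top))
      rw [Subgroup.rank_congr (Subgroup.map_top_of_surjective _
        (QuotientGroup.mk'_surjective _))] at this
      rwa [Group.rank_congr Subgroup.topEquiv, Group.rank_congr Subgroup.topEquiv] at this
    rwa [Subgroup.rank_map_mk' hG hTL, hGrank] at h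
  have hcomm := AInv.commutator_sq_top_le hA hG hmax
  intro H hH hHtop
  have hL : H ⊔ (⊤ : Subgroup G).sq ≠ ⊤ := fun h => hHtop (frattini_nongenerating
    (top_le_iff.1 (h.ge.trans (sup_le_sup_left (Subgroup.sq_top_le_frattini hG) H))))
  have hTop : AInv A (⊤ : Subgroup G) := fun _ _ _ => Subgroup.mem_top _
  refine lt_of_le_of_lt ?_ (hmax _ (hH.sup hTop.sq) le_sup_right hL)
  rw [← Nat.pow_le_pow_iff_right (a := 2) (by norm_num), Subgroup.two_pow_rank hG,
    Subgroup.two_pow_rank hG]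
  exact Subgroup.relIndex_sq_le_relIndex_sq_sup (Subgroup.sq_le _) le_rfl
    ((Subgroup.commutator_mono le_top le_rfl).trans ((Subgroup.commutator_comm_le _ _).trans hcomm))
    (Subgroup.sq_mono le_top) (Subgroup.relIndex_sq_le_of_le hG le_rfl hcomm inf_le_right)
end
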